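/- Let n be a positive integer, H = ℚ(ζ_n + ζ_n⁻¹), ℓ an odd prime with q ≡ 1 (mod ℓ) for some prime factor q of n, K_ℓ the degree-ℓ subfield of ℚ(ζ_q + ζ_q⁻¹), K_2 ⊆ H a real quadratic subfield, K_{2ℓ} = K_2·K_ℓ, and for i with ℓ^i exactly dividing [H:ℚ], let K_{2ℓ^i} be a subfield of H with K_{2ℓ} ⊆ K_{2ℓ^i} and [K_{2ℓ^i}:K_{2ℓ}] = ℓ^{i-1}. Assume the ℓ-class number of H is ℓ^m, the ℓ-class number of K_2 is ℓ^{m-1}, the ℓ-class number of K_{2ℓ} is ℓ^{m-1}, and ℓ | [H : K_{2ℓ}]. If the ℓ-class number of K_{2ℓ^i} is ℓ^{m-1}, then the ℓ-rank of the class group of H equals 1 + r_{2,ℓ}, where r_{2,ℓ} is the ℓ-rank of the class group of K_2. -/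

import Mathlib

open NumberField IntermediateField Module
open scoped nonZeroDivisors

noncomputable section

namespace PaperStmt

/-- `ζ_n = exp(2πi/n)`, a primitive `n`-th root of unity (for `n > 0`). -/
def zetaC (n : ℕ) : ℂ := Complex.exp (2 * (Real.pi : ℂ) * Complex.I / n)

/-- The maximal real subfield `ℚ(ζ_n + ζ_n⁻¹)` of the cyclotomic field `ℚ(ζ_n)`. -/
def realCyclo (n : ℕ) : IntermediateField ℚ ℂ := ℚ⟮zetaC n + (zetaC n)⁻¹⟯

lemma isIntegral_of_pow_eq_one {x : ℂ} {k : ℕ} (hk : k ≠ 0) (h : x ^ k = 1) :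
    IsIntegral ℚ x :=
  ⟨Polynomial.X ^ k - Polynomial.C 1, Polynomial.monic_X_pow_sub_C 1 hk, by
    simp [h]⟩

lemma zetaC_pow (n : ℕ) (hn : n ≠ 0) : zetaC n ^ n = 1 := by
  have hn' : (n : ℂ) ≠ 0 := Nat.cast_ne_zero.mpr hn
  rw [zetaC, ← Complex.exp_nat_mul, mul_comm ((n : ℂ)), div_mul_cancel₀ _ hn',
    Complex.exp_two_pi_mul_I]

lemma isIntegral_zetaC_add_inv (n : ℕ) : IsIntegral ℚ (zetaC n + (zetaC n)⁻¹) := by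
  rcases eq_or_ne n 0 with h | h
  · have h1 : zetaC 0 = 1 := by simp [zetaC]
    subst h
    rw [h1, inv_one]
    exact isIntegral_one.add isIntegral_one
  · exact (isIntegral_of_pow_eq_one h (zetaC_pow n h)).add
      (isIntegral_of_pow_eq_one h (by rw [inv_pow, zetaC_pow n h, inv_one]))

instance (n : ℕ) : FiniteDimensional ℚ (realCyclo n) :=
  IntermediateField.adjoin.finiteDimensional (isIntegral_zetaC_add_inv n)

instance (E : IntermediateField ℚ ℂ) [FiniteDimensional ℚ E] : NumberField E := ⟨⟩

/-- The `p`-part (`p`-primary component / `p`-Sylow subgroup) of a commutative group. -/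
def pPart (G : Type*) [CommGroup G] (p : ℕ) (hp : p.Prime) : Subgroup G :=
  haveI : Fact p.Prime := ⟨hp⟩
  CommGroup.primaryComponent G p

/-- The `p`-class number: the order of the `p`-part. -/
def pCard (G : Type*) [CommGroup G] (p : ℕ) (hp : p.Prime) : ℕ :=
  Nat.card (pPart G p hp)

/-- The `p`-rank: `dim_{F_p} (G_p / G_p^p)`, read off as the exponent of `p`
in the order of the elementary abelian group `G_p / G_p^p`. -/
def pRank (G : Type*) [CommGroup G] (p : ℕ) (hp : p.Prime) : ℕ :=
  (Nat.card
    (↥(pPart G p hp) ⧸ (powMonoidHom p : ↥(pPart G p hp) →* ↥(pPart G p hp)).range)).factorization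
    p

/-- `t` is the homomorphism of class groups induced by extension of ideals along `F ⊆ K`:
it sends the class of a nonzero ideal `I` of `𝓞 F` to the class of `I · 𝓞 K`. -/
def IsClassGroupExtHom {F K : IntermediateField ℚ ℂ} [NumberField F] [NumberField K]
    (hFK : F ≤ K) (t : ClassGroup (𝓞 F) →* ClassGroup (𝓞 K)) : Prop :=
  ∀ (I : (Ideal (𝓞 F))⁰) (J : (Ideal (𝓞 K))⁰),
    Ideal.map (RingOfIntegers.mapRingHom (IntermediateField.inclusion hFK))
        (I : Ideal (𝓞 F)) = (J : Ideal (𝓞 K)) →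
    t (ClassGroup.mk0 I) = ClassGroup.mk0 J

section EulerProduct

open IsDedekindDomain Filter Topology

variable {R : Type*} [CommRing R] [IsDedekindDomain R]

open scoped Classical in
/-- The restriction of `f` to the ideals not divisible by any prime of the finite set `S`. -/
noncomputable def awayFrom (f : Ideal R →*₀ ℂ) (S : Finset (HeightOneSpectrum R)) (I : Ideal R) : ℂ :=
  if ∀ Q ∈ S, ¬ Q.asIdeal ∣ I then f I else 0

omit [IsDedekindDomain R] in
lemma norm_awayFrom_le (f : Ideal R →*₀ ℂ) (S : Finset (HeightOneSpectrum R)) (I : Ideal R) :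
    ‖awayFrom f S I‖ ≤ ‖f I‖ := by
  unfold awayFrom
  split_ifs <;> simp

omit [IsDedekindDomain R] in
lemma summable_awayFrom {f : Ideal R →*₀ ℂ} (hf : Summable fun I ↦ ‖f I‖)
    (S : Finset (HeightOneSpectrum R)) : Summable (awayFrom f S) :=
  Summable.of_norm_bounded hf (norm_awayFrom_le f S)

open scoped Classical in
lemma tsum_awayFrom_insert {f : Ideal R →*₀ ℂ} (hf : Summable fun I ↦ ‖f I‖)
    {S : Finset (HeightOneSpectrum R)} {P : HeightOneSpectrum R} (hP : P ∉ S) :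
    ∑' I, awayFrom f (insert P S) I = (1 - f P.asIdeal) * ∑' I, awayFrom f S I := by
  have hinj : Function.Injective fun J : Ideal R ↦ P.asIdeal * J :=
    fun J J' h ↦ mul_left_cancel₀ P.ne_bot h
  have hmul : ∀ J, awayFrom f S (P.asIdeal * J) = f P.asIdeal * awayFrom f S J := by
    intro J
    have : (∀ Q ∈ S, ¬ Q.asIdeal ∣ P.asIdeal * J) ↔ ∀ Q ∈ S, ¬ Q.asIdeal ∣ J := by
      refine forall₂_congr fun Q hQ ↦ not_congr ⟨fun h ↦ ?_, fun h ↦ h.mul_left _⟩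
      refine (Q.prime.dvd_mul.mp h).resolve_left fun h' ↦ hP ?_
      have : Q.asIdeal = P.asIdeal :=
        ((P.isMaximal.eq_of_le Q.isPrime.ne_top (Ideal.dvd_iff_le.mp h'))).symm
      rwa [← HeightOneSpectrum.ext this]
    simp only [awayFrom, this, map_mul, mul_ite, mul_zero]
  have hsplit : ∀ I, awayFrom f S I = awayFrom f (insert P S) I +
      if P.asIdeal ∣ I then awayFrom f S I else 0 := by
    intro I
    by_cases h : P.asIdeal ∣ I <;> simp [awayFrom, h]
  have hsum : ∑' I, (if P.asIdeal ∣ I then awayFrom f S I else 0) =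
      f P.asIdeal * ∑' I, awayFrom f S I := by
    rw [← hinj.tsum_eq, ← tsum_mul_left]
    · simp [hmul]
    · intro I hI
      by_contra h
      refine hI (if_neg fun ⟨J, hJ⟩ ↦ h ⟨J, hJ.symm⟩)
  have h2 : Summable fun I ↦ if P.asIdeal ∣ I then awayFrom f S I else 0 := by
    refine Summable.of_norm_bounded hf fun I ↦ ?_
    split_ifs
    · exact norm_awayFrom_le f S I
    · simp
  have h3 := (summable_awayFrom hf (insert P S)).tsum_add h2
  rw [← tsum_congr hsplit, hsum] at h3
  linear_combination -h3

lemma prod_mul_tsum_eq_tsum_awayFrom {f : Ideal R →*₀ ℂ} (hf : Summable fun I ↦ ‖f I‖)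
    (S : Finset (HeightOneSpectrum R)) :
    (∏ P ∈ S, (1 - f P.asIdeal)) * ∑' I, f I = ∑' I, awayFrom f S I := by
  classical
  induction S using Finset.induction_on with
  | empty => simp [awayFrom]
  | insert P S hP ih => rw [Finset.prod_insert hP, mul_assoc, ih, tsum_awayFrom_insert hf hP]

/-- The Euler product over the primes of a Dedekind domain. -/
theorem tendsto_prod_mul_tsum {f : Ideal R →*₀ ℂ} (hf : Summable fun I ↦ ‖f I‖) :
    Tendsto (fun S : Finset (HeightOneSpectrum R) ↦
      (∏ P ∈ S, (1 - f P.asIdeal)) * ∑' I, f I) atTop (𝓝 1) := by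
  classical
  simp_rw [prod_mul_tsum_eq_tsum_awayFrom hf]
  have h1 : ∑' I : Ideal R, (if I = ⊤ then (1 : ℂ) else 0) = 1 := tsum_ite_eq _ _
  rw [← h1]
  refine tendsto_tsum_of_dominated_convergence hf (fun I ↦ ?_)
    (Eventually.of_forall fun S ↦ norm_awayFrom_le f S)
  refine tendsto_const_nhds.congr' ?_
  rcases eq_or_ne I ⊤ with rfl | hI
  · refine Eventually.of_forall fun S ↦ ?_
    have : ∀ Q ∈ S, ¬ Q.asIdeal ∣ (⊤ : Ideal R) := fun Q _ h ↦
      Q.isPrime.ne_top (top_le_iff.mp (Ideal.dvd_iff_le.mp h))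
    simp only [awayFrom]
    rw [if_pos this, if_true, ← Ideal.one_eq_top, map_one]
  · rcases eq_or_ne I 0 with rfl | hI0
    · refine Eventually.of_forall fun S ↦ ?_
      simp only [awayFrom, map_zero, ite_self, if_neg hI]
    · obtain ⟨M, hM, hIM⟩ := Ideal.exists_le_maximal I hI
      have hM0 : M ≠ ⊥ := fun h ↦ hI0 (le_bot_iff.mp (h ▸ hIM) : I = ⊥)
      filter_upwards [eventually_ge_atTop {⟨M, hM.isPrime, hM0⟩}] with S hS
      simp only [awayFrom]
      rw [if_neg hI, if_neg]
      push Not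
      exact ⟨_, hS (Finset.mem_singleton_self _), Ideal.dvd_iff_le.mpr hIM⟩

lemma norm_one_sub_mul_exp_re_bounds {z : ℂ} (hz : ‖z‖ ≤ 1 / 2) :
    Real.exp (-‖z‖ ^ 2) ≤ ‖1 - z‖ * Real.exp z.re ∧
      ‖1 - z‖ * Real.exp z.re ≤ Real.exp (‖z‖ ^ 2) := by
  have h1 : ‖Complex.log (1 + -z) - -z‖ ≤ ‖z‖ ^ 2 := by
    have := Complex.norm_log_one_add_sub_self_le (z := -z) (by rw [norm_neg]; linarith)
    rw [norm_neg] at this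
    refine this.trans ?_
    have h2 : (1 - ‖z‖)⁻¹ ≤ 2 := by
      rw [inv_le_comm₀ (by linarith) two_pos]
      linarith
    nlinarith [sq_nonneg ‖z‖]
  have hne : 1 + -z ≠ 0 := by
    intro h
    have : z = 1 := by linear_combination -h
    rw [this] at hz
    norm_num at hz
  have h3 := (Complex.abs_re_le_norm _).trans h1
  rw [Complex.sub_re, Complex.log_re, Complex.neg_re, abs_le] at h3
  have h4 : ‖1 - z‖ = Real.exp (Real.log ‖1 + -z‖) := by
    rw [Real.exp_log (norm_pos_iff.mpr hne), sub_eq_add_neg]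
  rw [h4, ← Real.exp_add, Real.exp_le_exp, Real.exp_le_exp]
  constructor <;> linarith [h3.1, h3.2]

/-- Comparison of a Dirichlet series over ideals with the sum over the primes. -/
theorem norm_tsum_ideal_bounds {f : Ideal R →*₀ ℂ} (hf : Summable fun I ↦ ‖f I‖)
    (hf2 : ∀ P : HeightOneSpectrum R, ‖f P.asIdeal‖ ≤ 1 / 2) :
    Real.exp (∑' P : HeightOneSpectrum R, (f P.asIdeal).re) ≤
        Real.exp (∑' P : HeightOneSpectrum R, ‖f P.asIdeal‖ ^ 2) * ‖∑' I, f I‖ ∧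
      ‖∑' I, f I‖ ≤ Real.exp (∑' P : HeightOneSpectrum R, ‖f P.asIdeal‖ ^ 2) *
        Real.exp (∑' P : HeightOneSpectrum R, (f P.asIdeal).re) := by
  have hinj : Function.Injective fun P : HeightOneSpectrum R ↦ P.asIdeal :=
    fun P Q h ↦ HeightOneSpectrum.ext h
  have hs : Summable fun P : HeightOneSpectrum R ↦ ‖f P.asIdeal‖ := hf.comp_injective hinj
  have hre : Summable fun P : HeightOneSpectrum R ↦ (f P.asIdeal).re :=
    Complex.reCLM.summable hs.of_norm
  have hsq : Summable fun P : HeightOneSpectrum R ↦ ‖f P.asIdeal‖ ^ 2 := by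
    refine Summable.of_nonneg_of_le (fun _ ↦ by positivity) (fun P ↦ ?_) hs
    nlinarith [hf2 P, norm_nonneg (f P.asIdeal)]
  have hlim : Tendsto (fun S : Finset (HeightOneSpectrum R) ↦
      (∏ P ∈ S, ‖1 - f P.asIdeal‖ * Real.exp (f P.asIdeal).re) * ‖∑' I, f I‖) atTop
      (𝓝 (Real.exp (∑' P : HeightOneSpectrum R, (f P.asIdeal).re))) := by
    have h1 := (tendsto_prod_mul_tsum hf).norm
    have h2 := (Real.continuous_exp.tendsto _).comp hre.hasSum
    have h3 := h1.mul h2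
    rw [norm_one, one_mul] at h3
    refine h3.congr fun S ↦ ?_
    simp only [Function.comp_apply, Finset.prod_mul_distrib, ← Real.exp_sum, norm_mul, norm_prod]
    ring
  have hsqlim : ∀ S : Finset (HeightOneSpectrum R),
      ∑ P ∈ S, ‖f P.asIdeal‖ ^ 2 ≤ ∑' P : HeightOneSpectrum R, ‖f P.asIdeal‖ ^ 2 :=
    fun S ↦ hsq.sum_le_tsum S fun _ _ ↦ by positivity
  constructor
  · refine le_of_tendsto' hlim fun S ↦ ?_
    gcongr
    calc ∏ P ∈ S, ‖1 - f P.asIdeal‖ * Real.exp (f P.asIdeal).re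
        ≤ ∏ P ∈ S, Real.exp (‖f P.asIdeal‖ ^ 2) :=
          Finset.prod_le_prod (fun _ _ ↦ by positivity)
            fun P _ ↦ (norm_one_sub_mul_exp_re_bounds (hf2 P)).2
      _ ≤ _ := by
          rw [← Real.exp_sum]
          exact Real.exp_le_exp.mpr (hsqlim S)
  · rw [mul_comm, ← div_le_iff₀ (Real.exp_pos _), div_eq_mul_inv, ← Real.exp_neg, mul_comm]
    refine ge_of_tendsto' hlim fun S ↦ ?_
    gcongr
    calc Real.exp (-∑' P : HeightOneSpectrum R, ‖f P.asIdeal‖ ^ 2)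
        ≤ ∏ P ∈ S, Real.exp (-‖f P.asIdeal‖ ^ 2) := by
          rw [← Real.exp_sum, Finset.sum_neg_distrib]
          exact Real.exp_le_exp.mpr (neg_le_neg (hsqlim S))
      _ ≤ _ := Finset.prod_le_prod (fun _ _ ↦ by positivity)
            fun P _ ↦ (norm_one_sub_mul_exp_re_bounds (hf2 P)).1

end EulerProduct

section CountingSeries

open Filter Topology

lemma card_le_eq_sum_Icc_card_eq {ι : Type*} {N : ι → ℕ} (hN : ∀ i, 0 < N i)
    (hfin : ∀ n, {i | N i = n}.Finite) (n : ℕ) :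
    ∑ k ∈ Finset.Icc 1 n, (Nat.card {i // N i = k} : ℝ) = Nat.card {i // N i ≤ n} := by
  have h1 := Finset.card_preimage_eq_sum_card_image_eq (f := N) (s := Finset.Icc 1 n)
    (fun k _ ↦ hfin k)
  rw [← Nat.cast_sum, Nat.cast_inj]
  refine Eq.trans ?_ (h1.symm.trans ?_)
  · rfl
  · refine Nat.card_congr (Equiv.subtypeEquivRight fun i ↦ ?_)
    simp [Nat.one_le_iff_ne_zero, (hN i).ne']

/-- A Dirichlet series over a set with linearly growing counting function. -/
theorem tendsto_sub_one_mul_tsum_rpow {ι : Type*} {N : ι → ℕ} (hN : ∀ i, 0 < N i)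
    (hfin : ∀ n, {i | N i = n}.Finite) {l : ℝ}
    (hl : Tendsto (fun n : ℕ ↦ (Nat.card {i // N i ≤ n} : ℝ) / n) atTop (𝓝 l)) :
    (∀ s : ℝ, 1 < s → Summable fun i ↦ (N i : ℝ) ^ (-s)) ∧
      Tendsto (fun s : ℝ ↦ (s - 1) * ∑' i, (N i : ℝ) ^ (-s)) (𝓝[>] 1) (𝓝 l) := by
  set f : ℕ → ℝ := fun k ↦ Nat.card {i // N i = k} with hf
  have hf0 : ∀ k, 0 ≤ f k := fun k ↦ Nat.cast_nonneg _
  have hlim : Tendsto (fun n : ℕ ↦ (∑ k ∈ Finset.Icc 1 n, f k) / (n : ℝ)) atTop (𝓝 l) := by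
    refine hl.congr fun n ↦ ?_
    rw [card_le_eq_sum_Icc_card_eq hN hfin]
  have hterm : ∀ s : ℝ, 1 < s → ∀ k, ∑' i : {i // N i = k}, (N i.1 : ℝ) ^ (-s) =
      f k * (k : ℝ) ^ (-s) := by
    intro s hs k
    rw [tsum_congr fun i : {i // N i = k} ↦ by rw [i.2], tsum_const, nsmul_eq_mul]
  have hcast : ∀ s : ℝ, 1 < s → ∀ k, LSeries.term (fun n ↦ (f n : ℂ)) s k =
      ((f k * (k : ℝ) ^ (-s) : ℝ) : ℂ) := by
    intro s hs k
    rcases eq_or_ne k 0 with rfl | hk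
    · have : (-s) ≠ 0 := by linarith
      simp [LSeries.term, Real.zero_rpow this]
    · rw [LSeries.term_of_ne_zero hk, Complex.ofReal_mul, Complex.ofReal_cpow (by positivity),
        Complex.ofReal_neg, Complex.cpow_neg, div_eq_mul_inv]
      simp
  have hsum : ∀ s : ℝ, 1 < s → Summable fun k ↦ f k * (k : ℝ) ^ (-s) := by
    intro s hs
    have h1 : LSeriesSummable (fun n ↦ (f n : ℂ)) (s : ℂ) := by
      refine LSeriesSummable_of_sum_norm_bigO_and_nonneg ?_ hf0 zero_le_one
        (by simpa using hs)
      simp_rw [Real.rpow_one]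
      refine Asymptotics.isBigO_of_div_tendsto_nhds ?_ l hlim
      filter_upwards [eventually_ne_atTop 0] with n hn h
      exact absurd h (Nat.cast_ne_zero.mpr hn)
    rw [LSeriesSummable, summable_congr (hcast s hs)] at h1
    exact_mod_cast h1
  have hsig : ∀ s : ℝ, 1 < s →
      Summable fun x : (k : ℕ) × {i // N i = k} ↦ (N x.2.1 : ℝ) ^ (-s) := by
    intro s hs
    refine (summable_sigma_of_nonneg fun _ ↦ by positivity).mpr ⟨fun k ↦ ?_, ?_⟩
    · have : Finite {i // N i = k} := hfin k
      exact Summable.of_finite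
    · exact (hsum s hs).congr fun k ↦ (hterm s hs k).symm
  have hsummable : ∀ s : ℝ, 1 < s → Summable fun i ↦ (N i : ℝ) ^ (-s) := fun s hs ↦
    (Equiv.sigmaFiberEquiv N).summable_iff.mp (hsig s hs)
  refine ⟨hsummable, ?_⟩
  have h2 := LSeries_tendsto_sub_mul_nhds_one_of_tendsto_sum_div_and_nonneg f hlim hf0
  have h3 : Tendsto (fun s : ℝ ↦ (((s - 1) * ∑' i, (N i : ℝ) ^ (-s) : ℝ) : ℂ)) (𝓝[>] 1)
      (𝓝 (l : ℂ)) := by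
    refine h2.congr' ?_
    filter_upwards [self_mem_nhdsWithin] with s hs
    have h4 : ∑' i, (N i : ℝ) ^ (-s) = ∑' k, f k * (k : ℝ) ^ (-s) := by
      rw [← (Equiv.sigmaFiberEquiv N).tsum_eq, ← tsum_congr (hterm s hs)]
      exact (hsig s hs).tsum_sigma' fun k ↦ by
        have : Finite {i // N i = k} := hfin k
        exact Summable.of_finite
    rw [LSeries, tsum_congr (hcast s hs), h4]
    push_cast
    rfl
  exact (Complex.continuous_re.tendsto _).comp h3

end CountingSeries

section IdealSeries

open Filter Topology NumberField IsDedekindDomain Ideal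
open scoped nonZeroDivisors

variable (K : Type*) [Field K] [NumberField K]

lemma absNorm_pos_of_nonZeroDivisors (I : (Ideal (𝓞 K))⁰) : 0 < absNorm (I : Ideal (𝓞 K)) :=
  Nat.pos_of_ne_zero (absNorm_eq_zero_iff.not.mpr (nonZeroDivisors.coe_ne_zero I))

lemma finite_nonZeroDivisors_absNorm_eq (n : ℕ) :
    {I : (Ideal (𝓞 K))⁰ | absNorm (I : Ideal (𝓞 K)) = n}.Finite :=
  (finite_setOfPred_absNorm_eq n).preimage Subtype.val_injective.injOn

lemma exists_tendsto_sub_one_mul_tsum_class :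
    ∃ κ : ℝ, 0 < κ ∧ ∀ C : ClassGroup (𝓞 K),
      Tendsto (fun s : ℝ ↦ (s - 1) * ∑' I : {I : (Ideal (𝓞 K))⁰ // ClassGroup.mk0 I = C},
        (absNorm (I.1 : Ideal (𝓞 K)) : ℝ) ^ (-s)) (𝓝[>] 1) (𝓝 κ) := by
  refine ⟨_, ?_, fun C ↦ (tendsto_sub_one_mul_tsum_rpow (ι := {I : (Ideal (𝓞 K))⁰ //
    ClassGroup.mk0 I = C}) (N := fun I ↦ absNorm (I.1 : Ideal (𝓞 K)))
    (fun I ↦ absNorm_pos_of_nonZeroDivisors K I.1)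
    (fun n ↦ (finite_nonZeroDivisors_absNorm_eq K n).preimage Subtype.val_injective.injOn)
    (((NumberField.Ideal.tendsto_norm_le_and_mk_eq_div_atTop K C).comp
      tendsto_natCast_atTop_atTop).congr fun n ↦ ?_)).2⟩
  · refine div_pos ?_ ?_
    · exact mul_pos (by positivity) (Units.regulator_pos K)
    · exact mul_pos (Nat.cast_pos.mpr (Units.torsionOrder_pos K)) <|
        Real.sqrt_pos_of_pos <| abs_pos.mpr (Int.cast_ne_zero.mpr (discr_ne_zero K))
  · simp only [Function.comp_apply, Nat.cast_le]
    congr 2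
    refine Nat.card_congr ((Equiv.subtypeEquivRight fun I ↦ and_comm).trans
      (Equiv.subtypeSubtypeEquivSubtypeInter _ _).symm)

lemma summable_and_tendsto_absNorm :
    (∀ s : ℝ, 1 < s → Summable fun I : (Ideal (𝓞 K))⁰ ↦ (absNorm (I : Ideal (𝓞 K)) : ℝ) ^ (-s)) ∧
      Tendsto (fun s : ℝ ↦ (s - 1) * ∑' I : (Ideal (𝓞 K))⁰,
        (absNorm (I : Ideal (𝓞 K)) : ℝ) ^ (-s)) (𝓝[>] 1) (𝓝 (dedekindZeta_residue K)) := by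
  refine tendsto_sub_one_mul_tsum_rpow (N := fun I : (Ideal (𝓞 K))⁰ ↦ absNorm (I : Ideal (𝓞 K)))
    (absNorm_pos_of_nonZeroDivisors K) (finite_nonZeroDivisors_absNorm_eq K) ?_
  rw [dedekindZeta_residue_def]
  refine ((NumberField.Ideal.tendsto_norm_le_div_atTop₀ K).comp
    tendsto_natCast_atTop_atTop).congr fun n ↦ ?_
  simp only [Function.comp_apply, Nat.cast_le]

variable {K}

lemma summable_absNorm {s : ℝ} (hs : 1 < s) :
    Summable fun I : Ideal (𝓞 K) ↦ (absNorm I : ℝ) ^ (-s) := by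
  have hinj : Function.Injective fun I : (Ideal (𝓞 K))⁰ ↦ (I : Ideal (𝓞 K)) :=
    Subtype.val_injective
  refine (hinj.summable_iff fun I hI ↦ ?_).mp ((summable_and_tendsto_absNorm K).1 s hs)
  have : I = 0 := by
    by_contra h
    exact hI ⟨⟨I, mem_nonZeroDivisors_of_ne_zero h⟩, rfl⟩
  rw [this, map_zero, Nat.cast_zero, Real.zero_rpow (by linarith)]

lemma norm_classChar_eq_one (ψ : ClassGroup (𝓞 K) →* ℂ) (C : ClassGroup (𝓞 K)) : ‖ψ C‖ = 1 := by
  refine Complex.norm_eq_one_of_pow_eq_one (n := Fintype.card (ClassGroup (𝓞 K))) ?_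
    Fintype.card_ne_zero
  rw [← map_pow, pow_card_eq_one, map_one]

open scoped Classical in
/-- The completely multiplicative function `I ↦ ψ([I]) N(I)^(-s)`. -/
noncomputable def classTerm (ψ : ClassGroup (𝓞 K) →* ℂ) (s : ℝ) : Ideal (𝓞 K) →*₀ ℂ where
  toFun I := if h : I = 0 then 0 else
    ψ (ClassGroup.mk0 ⟨I, mem_nonZeroDivisors_of_ne_zero h⟩) * ((absNorm I : ℝ) ^ (-s) : ℝ)
  map_zero' := by simp
  map_one' := by
    rw [dif_neg one_ne_zero]
    have : (⟨1, mem_nonZeroDivisors_of_ne_zero one_ne_zero⟩ : (Ideal (𝓞 K))⁰) = 1 := rfl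
    rw [this]
    simp
  map_mul' I J := by
    by_cases hI : I = 0
    · simp [hI]
    by_cases hJ : J = 0
    · simp [hJ]
    rw [dif_neg hI, dif_neg hJ, dif_neg (mul_ne_zero hI hJ)]
    have : (⟨I * J, mem_nonZeroDivisors_of_ne_zero (mul_ne_zero hI hJ)⟩ : (Ideal (𝓞 K))⁰) =
      ⟨I, mem_nonZeroDivisors_of_ne_zero hI⟩ * ⟨J, mem_nonZeroDivisors_of_ne_zero hJ⟩ := rfl
    rw [this, map_mul, map_mul, map_mul, Nat.cast_mul,
      Real.mul_rpow (Nat.cast_nonneg _) (Nat.cast_nonneg _), Complex.ofReal_mul]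
    ring

lemma classTerm_coe (ψ : ClassGroup (𝓞 K) →* ℂ) (s : ℝ) (I : (Ideal (𝓞 K))⁰) :
    classTerm ψ s I =
      ψ (ClassGroup.mk0 I) * ((absNorm (I : Ideal (𝓞 K)) : ℝ) ^ (-s) : ℝ) :=
  dif_neg (nonZeroDivisors.coe_ne_zero I)

/-- The completely multiplicative function `I ↦ χ(N(I)) ψ([I]) N(I)^(-s)`. -/
noncomputable def rayTerm {n : ℕ} (χ : DirichletCharacter ℂ n) (ψ : ClassGroup (𝓞 K) →* ℂ)
    (s : ℝ) : Ideal (𝓞 K) →*₀ ℂ where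
  toFun I := χ (absNorm I) * classTerm ψ s I
  map_zero' := by rw [map_zero (classTerm ψ s), mul_zero]
  map_one' := by rw [map_one (classTerm ψ s), map_one, Nat.cast_one, map_one, mul_one]
  map_mul' I J := by
    simp only [map_mul, Nat.cast_mul]
    ring

lemma rayTerm_apply {n : ℕ} (χ : DirichletCharacter ℂ n) (ψ : ClassGroup (𝓞 K) →* ℂ)
    (s : ℝ) (I : Ideal (𝓞 K)) : rayTerm χ ψ s I = χ (absNorm I) * classTerm ψ s I := rfl

lemma norm_classTerm_le (ψ : ClassGroup (𝓞 K) →* ℂ) (s : ℝ) (I : Ideal (𝓞 K)) :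
    ‖classTerm ψ s I‖ ≤ (absNorm I : ℝ) ^ (-s) := by
  by_cases h : I = 0
  · rw [h, map_zero, norm_zero]
    positivity
  · have := classTerm_coe ψ s ⟨I, mem_nonZeroDivisors_of_ne_zero h⟩
    rw [this, norm_mul, norm_classChar_eq_one, one_mul, Complex.norm_real,
      Real.norm_of_nonneg (by positivity)]

lemma norm_rayTerm_le {n : ℕ} (χ : DirichletCharacter ℂ n) (ψ : ClassGroup (𝓞 K) →* ℂ)
    (s : ℝ) (I : Ideal (𝓞 K)) : ‖rayTerm χ ψ s I‖ ≤ (absNorm I : ℝ) ^ (-s) := by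
  rw [rayTerm_apply, norm_mul]
  exact (mul_le_of_le_one_left (norm_nonneg _) (χ.norm_le_one _)).trans (norm_classTerm_le ψ s I)

lemma two_le_absNorm (P : HeightOneSpectrum (𝓞 K)) : 2 ≤ absNorm P.asIdeal := by
  have h0 : absNorm P.asIdeal ≠ 0 := absNorm_eq_zero_iff.not.mpr P.ne_bot
  have h1 : absNorm P.asIdeal ≠ 1 := absNorm_eq_one_iff.not.mpr P.isPrime.ne_top
  omega

lemma summable_prime_absNorm {s : ℝ} (hs : 1 < s) :
    Summable fun P : HeightOneSpectrum (𝓞 K) ↦ (absNorm P.asIdeal : ℝ) ^ (-s) :=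
  (summable_absNorm hs).comp_injective fun _ _ h ↦ HeightOneSpectrum.ext h

/-- A bound for the contribution of higher prime powers to logarithms of Euler products. -/
noncomputable def primeSqSum (K : Type*) [Field K] [NumberField K] : ℝ :=
  ∑' P : HeightOneSpectrum (𝓞 K), (absNorm P.asIdeal : ℝ) ^ (-2 : ℝ)

theorem norm_tsum_bounds {s : ℝ} (hs : 1 < s) {f : Ideal (𝓞 K) →*₀ ℂ}
    (hf : ∀ I, ‖f I‖ ≤ (absNorm I : ℝ) ^ (-s)) :
    Real.exp (∑' P : HeightOneSpectrum (𝓞 K), (f P.asIdeal).re) ≤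
        Real.exp (primeSqSum K) * ‖∑' I, f I‖ ∧
      ‖∑' I, f I‖ ≤ Real.exp (primeSqSum K) *
        Real.exp (∑' P : HeightOneSpectrum (𝓞 K), (f P.asIdeal).re) := by
  have hsum : Summable fun I ↦ ‖f I‖ :=
    Summable.of_nonneg_of_le (fun _ ↦ norm_nonneg _) hf (summable_absNorm hs)
  have h1 : ∀ P : HeightOneSpectrum (𝓞 K), ‖f P.asIdeal‖ ≤ (absNorm P.asIdeal : ℝ) ^ (-1 : ℝ) :=
    fun P ↦ (hf _).trans (Real.rpow_le_rpow_of_exponent_le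
      (by exact_mod_cast (two_le_absNorm P).trans' one_le_two) (by linarith))
  have h2 : ∀ P : HeightOneSpectrum (𝓞 K), ‖f P.asIdeal‖ ≤ 1 / 2 := fun P ↦ by
    refine (h1 P).trans ?_
    rw [Real.rpow_neg_one, one_div]
    exact inv_anti₀ two_pos (by exact_mod_cast two_le_absNorm P)
  have h3 : ∑' P : HeightOneSpectrum (𝓞 K), ‖f P.asIdeal‖ ^ 2 ≤ primeSqSum K := by
    have h4 : ∀ P : HeightOneSpectrum (𝓞 K), ‖f P.asIdeal‖ ^ 2 ≤
        (absNorm P.asIdeal : ℝ) ^ (-2 : ℝ) := fun P ↦ by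
      refine (pow_le_pow_left₀ (norm_nonneg _) (h1 P) 2).trans (le_of_eq ?_)
      rw [← Real.rpow_mul_natCast (Nat.cast_nonneg _)]
      norm_num
    exact Summable.tsum_le_tsum h4 (Summable.of_nonneg_of_le (fun _ ↦ by positivity) h4
      (summable_prime_absNorm one_lt_two)) (summable_prime_absNorm one_lt_two)
  obtain ⟨h5, h6⟩ := norm_tsum_ideal_bounds hsum h2
  constructor
  · refine h5.trans ?_
    gcongr
  · refine h6.trans ?_
    gcongr

lemma tsum_classTerm (ψ : ClassGroup (𝓞 K) →* ℂ) {s : ℝ} (hs : 1 < s) (g : ℕ → ℂ)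
    (hg : ∀ k, ‖g k‖ ≤ 1) :
    ∑' I : Ideal (𝓞 K), g (absNorm I) * classTerm ψ s I =
      ∑ C, ψ C * ∑' I : {I : (Ideal (𝓞 K))⁰ // ClassGroup.mk0 I = C},
        g (absNorm (I.1 : Ideal (𝓞 K))) * ((absNorm (I.1 : Ideal (𝓞 K)) : ℝ) ^ (-s) : ℝ) := by
  have hinj : Function.Injective fun I : (Ideal (𝓞 K))⁰ ↦ (I : Ideal (𝓞 K)) :=
    Subtype.val_injective
  have hsupp : (Function.support fun I : Ideal (𝓞 K) ↦ g (absNorm I) * classTerm ψ s I) ⊆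
      Set.range fun I : (Ideal (𝓞 K))⁰ ↦ (I : Ideal (𝓞 K)) := by
    intro I hI
    refine ⟨⟨I, mem_nonZeroDivisors_of_ne_zero fun h ↦ hI ?_⟩, rfl⟩
    simp only [h, map_zero (classTerm ψ s), mul_zero]
  rw [← hinj.tsum_eq hsupp]
  have hsum : Summable fun I : Ideal (𝓞 K) ↦ g (absNorm I) * classTerm ψ s I := by
    refine Summable.of_norm_bounded (summable_absNorm hs) fun I ↦ ?_
    rw [norm_mul]
    exact (mul_le_of_le_one_left (norm_nonneg _) (hg _)).trans (norm_classTerm_le ψ s I)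
  have hsum' := (Equiv.sigmaFiberEquiv (ClassGroup.mk0 (R := 𝓞 K))).summable_iff.mpr
    (hsum.comp_injective hinj)
  rw [← (Equiv.sigmaFiberEquiv (ClassGroup.mk0 (R := 𝓞 K))).tsum_eq]
  refine (hsum'.tsum_sigma' fun C ↦ hsum'.comp_injective sigma_mk_injective).trans ?_
  rw [tsum_fintype]
  refine Finset.sum_congr rfl fun C _ ↦ ?_
  rw [← tsum_mul_left]
  refine tsum_congr fun I ↦ ?_
  change g (absNorm (I.1 : Ideal (𝓞 K))) * classTerm ψ s (I.1 : Ideal (𝓞 K)) = _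
  rw [classTerm_coe, I.2]
  ring

/-- The `L`-series of a nontrivial class group character has no pole at `s = 1`. -/
theorem tendsto_sub_one_mul_tsum_classTerm {ψ : ClassGroup (𝓞 K) →* ℂ} (hψ : ψ ≠ 1) :
    Tendsto (fun s : ℝ ↦ (s - 1) * ‖∑' I, classTerm ψ s I‖) (𝓝[>] 1) (𝓝 0) := by
  obtain ⟨κ, -, hκ⟩ := exists_tendsto_sub_one_mul_tsum_class K
  have h1 : Tendsto (fun s : ℝ ↦ ∑ C, ψ C * (((s - 1) *
      ∑' I : {I : (Ideal (𝓞 K))⁰ // ClassGroup.mk0 I = C},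
        (absNorm (I.1 : Ideal (𝓞 K)) : ℝ) ^ (-s) : ℝ) : ℂ)) (𝓝[>] 1) (𝓝 (∑ C, ψ C * (κ : ℂ))) :=
    tendsto_finsetSum _ fun C _ ↦ ((Complex.continuous_ofReal.tendsto κ).comp (hκ C)).const_mul _
  have h2 : ∑ C, ψ C * (κ : ℂ) = 0 := by
    rw [← Finset.sum_mul]
    obtain ⟨c, hc⟩ : ∃ c, ψ c ≠ 1 := by
      by_contra! h
      exact hψ (MonoidHom.ext h)
    have h3 : ψ c * ∑ C, ψ C = ∑ C, ψ C := by
      rw [Finset.mul_sum]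
      exact Fintype.sum_equiv (Equiv.mulLeft c) _ _ fun x ↦ (map_mul ψ c x).symm
    have h4 : (ψ c - 1) * ∑ C, ψ C = 0 := by linear_combination h3
    rw [(mul_eq_zero.mp h4).resolve_left (sub_ne_zero.mpr hc), zero_mul]
  rw [h2] at h1
  have h3 := h1.norm
  rw [norm_zero] at h3
  refine h3.congr' ?_
  filter_upwards [self_mem_nhdsWithin] with s hs
  have h4 := tsum_classTerm ψ hs (fun _ ↦ 1) (by simp)
  simp only [one_mul] at h4
  have hs' : 0 ≤ s - 1 := sub_nonneg.mpr (Set.mem_Ioi.mp hs).le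
  rw [h4, ← Real.norm_of_nonneg hs', ← Complex.norm_real, ← norm_mul, Finset.mul_sum]
  congr 1
  refine Finset.sum_congr rfl fun C _ ↦ ?_
  rw [← Complex.ofReal_tsum, Complex.norm_real, Real.norm_of_nonneg hs']
  push_cast
  ring

lemma tsum_classTerm_one (s : ℝ) :
    ∑' I : Ideal (𝓞 K), classTerm 1 s I =
      ((∑' I : (Ideal (𝓞 K))⁰, (absNorm (I : Ideal (𝓞 K)) : ℝ) ^ (-s) : ℝ) : ℂ) := by
  have hinj : Function.Injective fun I : (Ideal (𝓞 K))⁰ ↦ (I : Ideal (𝓞 K)) :=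
    Subtype.val_injective
  rw [← hinj.tsum_eq, Complex.ofReal_tsum]
  · simp [classTerm_coe]
  · intro I hI
    refine ⟨⟨I, mem_nonZeroDivisors_of_ne_zero fun h ↦ hI ?_⟩, rfl⟩
    rw [h, map_zero]

theorem tendsto_sub_one_mul_tsum_classTerm_one :
    Tendsto (fun s : ℝ ↦ (s - 1) * ‖∑' I : Ideal (𝓞 K), classTerm 1 s I‖) (𝓝[>] 1)
      (𝓝 (dedekindZeta_residue K)) := by
  refine (summable_and_tendsto_absNorm K).2.congr' ?_
  filter_upwards with s
  rw [tsum_classTerm_one, Complex.norm_real, Real.norm_of_nonneg]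
  exact tsum_nonneg fun _ ↦ by positivity

end IdealSeries

section Tent

open Filter Topology

/-- A tent function of `log |x| - log |y|`, supported on a cone around the diagonals. -/
noncomputable def tent (c x y : ℝ) : ℝ := max 0 (1 - |Real.log x - Real.log y| / c)

/-- The function `|xy|^(-s)` cut off by a tent function. -/
noncomputable def tentPow (c s x y : ℝ) : ℝ := tent c x y * |x * y| ^ (-s)

lemma tent_nonneg (c x y : ℝ) : 0 ≤ tent c x y := le_max_left _ _

lemma tent_le_one {c : ℝ} (hc : 0 < c) (x y : ℝ) : tent c x y ≤ 1 :=
  max_le zero_le_one (sub_le_self _ (by positivity))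

lemma tentPow_nonneg (c s x y : ℝ) : 0 ≤ tentPow c s x y :=
  mul_nonneg (tent_nonneg c x y) (by positivity)

lemma tentPow_zero (c : ℝ) {s : ℝ} (hs : 1 < s) : tentPow c s 0 0 = 0 := by
  rw [tentPow, mul_zero, abs_zero, Real.zero_rpow (by linarith), mul_zero]

lemma tentPow_le {c : ℝ} (hc : 0 < c) (s x y : ℝ) : tentPow c s x y ≤ |x * y| ^ (-s) :=
  mul_le_of_le_one_left (by positivity) (tent_le_one hc x y)

lemma le_of_tent_ne_zero {c x y : ℝ} (hc : 0 < c) (hx : x ≠ 0) (hy : y ≠ 0)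
    (h : tent c x y ≠ 0) :
    Real.exp (-c) * max |x| |y| ≤ |x| ∧ Real.exp (-c) * max |x| |y| ≤ |y| := by
  have h1 : |Real.log x - Real.log y| < c := by
    by_contra! h2
    exact h (max_eq_left (sub_nonpos.mpr ((one_le_div hc).mpr h2)))
  obtain ⟨h2, h3⟩ := abs_lt.mp h1
  have hx' := abs_pos.mpr hx
  have hy' := abs_pos.mpr hy
  have hec : Real.exp (-c) ≤ 1 := Real.exp_le_one_iff.mpr (by linarith)
  have key : ∀ {u v : ℝ}, 0 < |u| → 0 < |v| → -c < Real.log u - Real.log v →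
      Real.exp (-c) * |v| ≤ |u| := fun {u v} hu hv huv ↦ by
    rw [← Real.exp_log hv, ← Real.exp_log hu, Real.log_abs, Real.log_abs, ← Real.exp_add]
    exact Real.exp_le_exp.mpr (by linarith)
  rw [mul_max_of_nonneg _ _ (Real.exp_pos _).le]
  exact ⟨max_le (mul_le_of_le_one_left hx'.le hec) (key hx' hy' h2),
    max_le (key hy' hx' (by linarith)) (mul_le_of_le_one_left hy'.le hec)⟩

lemma le_of_tentPow_ne_zero {c s x y : ℝ} (hc : 0 < c) (hs : 1 < s) (h : tentPow c s x y ≠ 0) :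
    Real.exp (-c) * max |x| |y| ≤ |x| ∧ Real.exp (-c) * max |x| |y| ≤ |y| := by
  obtain ⟨h1, h2⟩ := mul_ne_zero_iff.mp h
  have h3 : x * y ≠ 0 := fun h3 ↦ h2 (by rw [h3, abs_zero, Real.zero_rpow (by linarith)])
  exact le_of_tent_ne_zero hc (left_ne_zero_of_mul h3) (right_ne_zero_of_mul h3) h1

lemma abs_log_sub_log_le {ρ V x y : ℝ} (hρ : 0 < ρ) (hx : ρ ≤ |x|) (hy : ρ ≤ |y|)
    (hV : |x - y| ≤ V) : |Real.log x - Real.log y| ≤ V / ρ := by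
  have key : ∀ {u v : ℝ}, ρ ≤ |u| → ρ ≤ |v| → |u - v| ≤ V →
      Real.log u - Real.log v ≤ V / ρ := fun {u v} hu hv huv ↦ by
    have hu' := hρ.trans_le hu
    have hv' := hρ.trans_le hv
    have hV0 : 0 ≤ V := (abs_nonneg _).trans huv
    rw [← Real.log_abs u, ← Real.log_abs v, ← Real.log_div hu'.ne' hv'.ne']
    refine (Real.log_le_sub_one_of_pos (div_pos hu' hv')).trans ?_
    rw [div_sub_one hv'.ne']
    exact div_le_div₀ hV0 ((abs_sub_abs_le_abs_sub u v).trans huv) hρ hv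
  exact abs_le.mpr ⟨by linarith [key hy hx (by rwa [abs_sub_comm])], key hx hy hV⟩

lemma abs_exp_sub_exp_le {p q B : ℝ} (hp : p ≤ B) (hq : q ≤ B) :
    |Real.exp p - Real.exp q| ≤ Real.exp B * |p - q| := by
  have key : ∀ {u v : ℝ}, u ≤ B → Real.exp u - Real.exp v ≤ Real.exp B * |u - v| :=
    fun {u v} hu ↦ by
      have h1 : Real.exp u - Real.exp v ≤ Real.exp u * (u - v) := by
        have h2 := mul_le_mul_of_nonneg_left (Real.add_one_le_exp (v - u)) (Real.exp_pos u).le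
        rw [← Real.exp_add, add_sub_cancel] at h2
        linarith
      exact h1.trans ((mul_le_mul_of_nonneg_left (le_abs_self _) (Real.exp_pos u).le).trans
        (mul_le_mul_of_nonneg_right (Real.exp_le_exp.mpr hu) (abs_nonneg _)))
  refine abs_le.mpr ⟨?_, key hp⟩
  have := key (v := p) hq
  rw [abs_sub_comm] at this
  linarith

lemma abs_mul_rpow_eq_exp {x y : ℝ} (hx : x ≠ 0) (hy : y ≠ 0) (s : ℝ) :
    |x * y| ^ (-s) = Real.exp (-s * (Real.log x + Real.log y)) := by
  rw [Real.rpow_def_of_pos (abs_pos.mpr (mul_ne_zero hx hy)), Real.log_abs,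
    Real.log_mul hx hy, mul_comm]

lemma abs_tentPow_sub_le_of_le {c s ρ V x y x' y' : ℝ} (hc : 0 < c) (hs : 1 < s) (hs' : s ≤ 2)
    (hρ : 1 ≤ ρ) (hx : ρ ≤ |x|) (hy : ρ ≤ |y|) (hx' : ρ ≤ |x'|) (hy' : ρ ≤ |y'|)
    (hxx : |x' - x| ≤ V) (hyy : |y' - y| ≤ V) :
    |tentPow c s x' y' - tentPow c s x y| ≤ (2 / c + 4) * V * (ρ ^ 3)⁻¹ := by
  have hρ0 : 0 < ρ := by linarith
  have hV : 0 ≤ V := (abs_nonneg _).trans hxx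
  have hlx := abs_log_sub_log_le hρ0 hx' hx hxx
  have hly := abs_log_sub_log_le hρ0 hy' hy hyy
  have hne : ∀ {u : ℝ}, ρ ≤ |u| → u ≠ 0 := fun h ↦ abs_pos.mp (hρ0.trans_le h)
  have hlog : ∀ {u : ℝ}, ρ ≤ |u| → Real.log ρ ≤ Real.log u := fun {u} h ↦ by
    rw [← Real.log_abs u]
    exact Real.log_le_log hρ0 h
  have hlogρ : 0 ≤ Real.log ρ := Real.log_nonneg hρ
  have hB : ∀ {u v : ℝ}, ρ ≤ |u| → ρ ≤ |v| →
      -s * (Real.log u + Real.log v) ≤ -(2 * Real.log ρ) := fun hu hv ↦ by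
    nlinarith [hlog hu, hlog hv]
  have hexp : Real.exp (-(2 * Real.log ρ)) = (ρ ^ 2)⁻¹ := by
    rw [Real.exp_neg, two_mul, Real.exp_add, Real.exp_log hρ0, sq]
  have ht : |tent c x' y' - tent c x y| ≤ 2 / c * (V / ρ) := by
    refine (abs_max_sub_max_le_max _ _ _ _).trans ?_
    rw [sub_self, abs_zero]
    refine max_le (by positivity) ?_
    rw [sub_sub_sub_cancel_left, ← sub_div, abs_div, abs_of_pos hc, div_mul_eq_mul_div]
    refine div_le_div_of_nonneg_right ?_ hc.le
    refine (abs_abs_sub_abs_le_abs_sub _ _).trans ?_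
    rw [abs_le] at *
    constructor <;> linarith
  have hP : |(|x' * y'| ^ (-s) - |x * y| ^ (-s))| ≤ (ρ ^ 2)⁻¹ * (4 * (V / ρ)) := by
    rw [abs_mul_rpow_eq_exp (hne hx') (hne hy'), abs_mul_rpow_eq_exp (hne hx) (hne hy), ← hexp]
    refine (abs_exp_sub_exp_le (hB hx' hy') (hB hx hy)).trans ?_
    gcongr
    rw [← mul_sub, abs_mul, abs_neg, abs_of_pos (by linarith : 0 < s)]
    have : |Real.log x' + Real.log y' - (Real.log x + Real.log y)| ≤ 2 * (V / ρ) := by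
      rw [abs_le] at *
      constructor <;> linarith
    calc _ ≤ 2 * (2 * (V / ρ)) := by gcongr
      _ = _ := by ring
  have hP' : |x' * y'| ^ (-s) ≤ (ρ ^ 2)⁻¹ := by
    rw [abs_mul_rpow_eq_exp (hne hx') (hne hy'), ← hexp]
    exact Real.exp_le_exp.mpr (hB hx' hy')
  calc |tentPow c s x' y' - tentPow c s x y|
      = |(tent c x' y' - tent c x y) * |x' * y'| ^ (-s) +
          tent c x y * (|x' * y'| ^ (-s) - |x * y| ^ (-s))| := by
        rw [tentPow, tentPow]
        ring_nf
    _ ≤ |tent c x' y' - tent c x y| * |x' * y'| ^ (-s) +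
          tent c x y * |(|x' * y'| ^ (-s) - |x * y| ^ (-s))| := by
        refine (abs_add_le _ _).trans (le_of_eq ?_)
        rw [abs_mul (_ - _), abs_mul (tent c x y), abs_of_nonneg (tent_nonneg c x y),
          abs_of_nonneg (by positivity : 0 ≤ |x' * y'| ^ (-s))]
    _ ≤ 2 / c * (V / ρ) * (ρ ^ 2)⁻¹ + 1 * ((ρ ^ 2)⁻¹ * (4 * (V / ρ))) := by
        gcongr
        exact tent_le_one hc x y
    _ = _ := by
        field_simp

/-- The function `tentPow c s` varies slowly at infinity, uniformly for `1 < s ≤ 2`. -/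
theorem exists_abs_tentPow_add_sub_le {c : ℝ} (hc : 0 < c) (a b : ℝ) :
    ∃ C R : ℝ, 0 ≤ C ∧ ∀ x y s : ℝ, 1 < s → s ≤ 2 → R ≤ max |x| |y| →
      |tentPow c s (x + a) (y + b) - tentPow c s x y| ≤ C * ((max |x| |y|) ^ 3)⁻¹ := by
  set V := max |a| |b| with hV
  set δ := Real.exp (-c) / 4 with hδ
  have hδ0 : 0 < δ := by positivity
  have hec : Real.exp (-c) ≤ 1 := Real.exp_le_one_iff.mpr (by linarith)
  have hV0 : 0 ≤ V := (abs_nonneg a).trans (le_max_left _ _)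
  have ha : |a| ≤ V := le_max_left _ _
  have hb : |b| ≤ V := le_max_right _ _
  refine ⟨(2 / c + 4) * V * (δ ^ 3)⁻¹, max (1 / δ) (V / δ), by positivity,
    fun x y s hs hs' hR ↦ ?_⟩
  set m := max |x| |y| with hm
  have h1 : 1 ≤ δ * m := by
    have := (le_max_left _ _).trans hR
    rwa [div_le_iff₀' hδ0] at this
  have h2 : V ≤ δ * m := by
    have := (le_max_right _ _).trans hR
    rwa [div_le_iff₀' hδ0] at this
  have hm0 : 0 < m := by
    by_contra! h
    nlinarith
  have hδ4 : Real.exp (-c) = 4 * δ := by rw [hδ]; ring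
  have hle : ∀ {u v e : ℝ}, |e| ≤ V → 2 * (δ * m) ≤ |u| → v = u + e ∨ u = v + e → δ * m ≤ |v| := by
    intro u v e he hu hv
    rcases hv with rfl | rfl
    · have := abs_sub_abs_le_abs_sub u (-e)
      rw [abs_neg, sub_neg_eq_add] at this
      linarith
    · have := abs_add_le v e
      linarith
  have hfin : ∀ {x' y' : ℝ}, tentPow c s x' y' ≠ 0 → m / 2 ≤ max |x'| |y'| →
      2 * (δ * m) ≤ |x'| ∧ 2 * (δ * m) ≤ |y'| := by
    intro x' y' h h'
    obtain ⟨h3, h4⟩ := le_of_tentPow_ne_zero hc hs h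
    rw [hδ4] at h3 h4
    constructor <;> nlinarith
  have main : (2 * (δ * m) ≤ |x + a| ∧ 2 * (δ * m) ≤ |y + b|) ∨
      (2 * (δ * m) ≤ |x| ∧ 2 * (δ * m) ≤ |y|) →
      |tentPow c s (x + a) (y + b) - tentPow c s x y| ≤
        (2 / c + 4) * V * (δ ^ 3)⁻¹ * (m ^ 3)⁻¹ := by
    intro h
    have h3 : (δ * m ≤ |x + a| ∧ δ * m ≤ |y + b|) ∧ (δ * m ≤ |x| ∧ δ * m ≤ |y|) := by
      rcases h with ⟨h4, h5⟩ | ⟨h4, h5⟩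
      · exact ⟨⟨by linarith, by linarith⟩, hle ha h4 (.inr rfl), hle hb h5 (.inr rfl)⟩
      · exact ⟨⟨hle ha h4 (.inl rfl), hle hb h5 (.inl rfl)⟩, by linarith, by linarith⟩
    have := abs_tentPow_sub_le_of_le hc hs hs' h1 h3.2.1 h3.2.2 h3.1.1 h3.1.2
      (by simpa using ha) (by simpa using hb)
    rwa [mul_pow, mul_inv, ← mul_assoc] at this
  by_cases hz : tentPow c s x y = 0
  · by_cases hz' : tentPow c s (x + a) (y + b) = 0
    · rw [hz, hz', sub_zero, abs_zero]
      positivity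
    · refine main (.inl (hfin hz' ?_))
      have hδ1 : δ ≤ 1 / 4 := by rw [hδ]; linarith
      have h3 := abs_sub_abs_le_abs_sub x (-a)
      have h4 := abs_sub_abs_le_abs_sub y (-b)
      rw [abs_neg, sub_neg_eq_add] at h3 h4
      have h5 : m - V ≤ max |x + a| |y + b| := by
        rw [sub_le_iff_le_add]
        refine max_le ?_ ?_
        · linarith [le_max_left |x + a| |y + b|]
        · linarith [le_max_right |x + a| |y + b|]
      nlinarith
  · exact main (.inr (hfin hz (by linarith)))

lemma tentPow_le_max_rpow {c : ℝ} (hc : 0 < c) {s : ℝ} (hs : 1 < s) (x y : ℝ) :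
    tentPow c s x y ≤ (Real.exp (-c)) ^ (-(2 * s)) * (max |x| |y|) ^ (-(2 * s)) := by
  have hm0 : 0 ≤ max |x| |y| := (abs_nonneg x).trans (le_max_left _ _)
  by_cases hz : tentPow c s x y = 0
  · rw [hz]
    positivity
  obtain ⟨h1, h2⟩ := le_of_tentPow_ne_zero hc hs hz
  refine (tentPow_le hc s x y).trans ?_
  rcases hm0.eq_or_lt with h0 | h0
  · exfalso
    have hx : x = 0 := abs_eq_zero.mp (le_antisymm (h0 ▸ le_max_left _ _) (abs_nonneg _))
    have hy : y = 0 := abs_eq_zero.mp (le_antisymm (h0 ▸ le_max_right _ _) (abs_nonneg _))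
    exact hz (by rw [hx, hy, tentPow_zero c hs])
  · rw [← Real.mul_rpow (Real.exp_pos _).le hm0, show -(2 * s) = 2 * -s by ring, Real.rpow_mul
      (by positivity), Real.rpow_two, abs_mul]
    refine Real.rpow_le_rpow_of_nonpos (by positivity) ?_ (by linarith)
    rw [sq]
    exact mul_le_mul h1 h2 (by positivity) (abs_nonneg x)

lemma hasSum_tent_int (y : ℝ) : HasSum (fun k : ℤ ↦ max 0 (1 - |y + k|)) 1 := by
  have h0 := Int.fract_nonneg y
  have h1 := Int.fract_lt_one y
  have h2 : (∑ k ∈ ({-⌊y⌋, -⌊y⌋ - 1} : Finset ℤ), (max 0 (1 - |y + k|) : ℝ)) = 1 := by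
    rw [Finset.sum_pair (by omega)]
    have h3 : y + ((-⌊y⌋ : ℤ) : ℝ) = Int.fract y := by rw [Int.fract]; push_cast; ring
    have h4 : y + ((-⌊y⌋ - 1 : ℤ) : ℝ) = Int.fract y - 1 := by rw [Int.fract]; push_cast; ring
    rw [h3, h4, abs_of_nonneg h0, abs_of_nonpos (by linarith), max_eq_right (by linarith),
      max_eq_right (by linarith)]
    ring
  have h6 : ∀ k ∉ ({-⌊y⌋, -⌊y⌋ - 1} : Finset ℤ), (max 0 (1 - |y + k|) : ℝ) = 0 := by
    intro k hk
    refine max_eq_left ?_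
    simp only [Finset.mem_insert, Finset.mem_singleton, not_or] at hk
    have h5 : y = ⌊y⌋ + Int.fract y := (Int.floor_add_fract y).symm
    rcases lt_or_ge k (-⌊y⌋) with hlt | hge
    · have h6 : k + ⌊y⌋ ≤ -2 := by omega
      have h7 : (k : ℝ) + ⌊y⌋ ≤ -2 := by exact_mod_cast h6
      rw [abs_of_nonpos] <;> linarith
    · have h6 : 1 ≤ k + ⌊y⌋ := by omega
      have h7 : (1 : ℝ) ≤ k + ⌊y⌋ := by exact_mod_cast h6
      rw [abs_of_nonneg] <;> linarith
  have h7 := hasSum_sum_of_ne_finset_zero (L := .unconditional ℤ) h6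
  rwa [h2] at h7

end Tent

section RealQuadratic

open Filter Topology NumberField Ideal
open scoped nonZeroDivisors

variable {K : Type*} [Field K] [NumberField K]

lemma exists_pair_embeddings (h2 : Module.finrank ℚ K = 2) [IsTotallyReal K] :
    ∃ σ τ : K →+* ℝ, (∀ x : K, ((Algebra.norm ℚ x : ℚ) : ℝ) = σ x * τ x) ∧
      ∀ w : InfinitePlace K, (∀ x, w x = |σ x|) ∨ ∀ x, w x = |τ x| := by
  classical
  have hcard : (Finset.univ : Finset (K →+* ℂ)).card = 2 := by
    rw [Finset.card_univ, Embeddings.card K ℂ, h2]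
  obtain ⟨φ, ψ, hne, huniv⟩ := Finset.card_eq_two.mp hcard
  have hφ := IsTotallyReal.complexEmbedding_isReal φ
  have hψ := IsTotallyReal.complexEmbedding_isReal ψ
  have hφ' := hφ.coe_embedding_apply
  have hψ' := hψ.coe_embedding_apply
  refine ⟨hφ.embedding, hψ.embedding, fun x ↦ ?_, fun w ↦ ?_⟩
  · have h1 := Algebra.norm_eq_prod_embeddings ℚ ℂ x
    rw [← Fintype.prod_equiv (RingHom.equivRatAlgHom K ℂ) (fun f ↦ f x) (fun φ ↦ φ x)
      fun _ ↦ by simp [RingHom.equivRatAlgHom_apply], huniv, Finset.prod_pair hne] at h1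
    apply Complex.ofReal_injective
    rw [Complex.ofReal_mul, hφ', hψ', ← h1]
    simp
  · have hw : ∀ x, w x = ‖w.embedding x‖ := fun x ↦ (InfinitePlace.norm_embedding_eq w x).symm
    have : w.embedding ∈ ({φ, ψ} : Finset (K →+* ℂ)) := huniv ▸ Finset.mem_univ _
    rcases Finset.mem_insert.mp this with h | h
    · refine .inl fun x ↦ ?_
      rw [hw, h, ← hφ', Complex.norm_real, Real.norm_eq_abs]
    · refine .inr fun x ↦ ?_
      rw [hw, Finset.mem_singleton.mp h, ← hψ', Complex.norm_real, Real.norm_eq_abs]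

open scoped Classical in
lemma summable_max_rpow (h2 : Module.finrank ℚ K = 2) {σ τ : K →+* ℝ}
    (hw : ∀ w : InfinitePlace K, (∀ x, w x = |σ x|) ∨ ∀ x, w x = |τ x|) {r : ℝ} (hr : 2 < r) :
    Summable fun x : 𝓞 K ↦ (max |σ x| |τ x|) ^ (-r) := by
  have h1 := ZLattice.summable_norm_rpow (E := mixedEmbedding.mixedSpace K)
    (mixedEmbedding.integerLattice K) (-r) (by
    rw [ZLattice.rank ℝ (mixedEmbedding.integerLattice K), mixedEmbedding.finrank, h2]
    norm_num
    exact hr)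
  let e : 𝓞 K → mixedEmbedding.integerLattice K := fun x ↦ ⟨mixedEmbedding K x, x, rfl⟩
  have he : Function.Injective e := fun x y hxy ↦
    RingOfIntegers.ext (mixedEmbedding_injective K (congrArg Subtype.val hxy))
  have h3 : ∀ x : 𝓞 K, ‖e x‖ ≤ max |σ x| |τ x| := fun x ↦ by
    change ‖mixedEmbedding K (x : K)‖ ≤ _
    rw [mixedEmbedding.norm_eq_sup'_normAtPlace]
    refine Finset.sup'_le _ _ fun w _ ↦ ?_
    rw [mixedEmbedding.normAtPlace_apply]
    rcases hw w with h | h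
    · exact (h x).le.trans (le_max_left _ _)
    · exact (h x).le.trans (le_max_right _ _)
  refine Summable.of_norm_bounded_eventually (h1.comp_injective he) ?_
  filter_upwards [(Set.finite_singleton (0 : 𝓞 K)).compl_mem_cofinite] with x hx
  have h4 : 0 < ‖e x‖ := by
    rw [norm_pos_iff]
    intro h
    refine hx (he (h.trans ?_))
    apply Subtype.ext
    change 0 = mixedEmbedding K ((0 : 𝓞 K) : K)
    simp
  rw [Real.norm_of_nonneg (by positivity)]
  exact Real.rpow_le_rpow_of_nonpos h4 (h3 x) (by linarith)

lemma card_infinitePlace_eq_two (h2 : Module.finrank ℚ K = 2) [IsTotallyReal K] :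
    Fintype.card (InfinitePlace K) = 2 := by
  have h := InfinitePlace.sum_mult_eq (K := K)
  simpa [h2] using h

lemma abs_mul_abs_unit {σ τ : K →+* ℝ}
    (hN : ∀ x : K, ((Algebra.norm ℚ x : ℚ) : ℝ) = σ x * τ x) (u : (𝓞 K)ˣ) :
    |σ (u : 𝓞 K)| * |τ (u : 𝓞 K)| = 1 := by
  rw [← abs_mul, ← hN, ← Rat.cast_abs]
  have h := (isUnit_iff_norm (K := K)).mp u.isUnit
  rw [RingOfIntegers.coe_norm] at h
  exact_mod_cast h

lemma exists_hasSum_units (h2 : Module.finrank ℚ K = 2) [IsTotallyReal K] {σ τ : K →+* ℝ}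
    (hN : ∀ x : K, ((Algebra.norm ℚ x : ℚ) : ℝ) = σ x * τ x)
    (hw : ∀ w : InfinitePlace K, (∀ x, w x = |σ x|) ∨ ∀ x, w x = |τ x|) :
    ∃ c : ℝ, 0 < c ∧ ∃ w : ℝ, 0 < w ∧ ∀ y : ℝ, HasSum (fun u : (𝓞 K)ˣ ↦
      max 0 (1 - |y + (Real.log (σ (u : 𝓞 K)) - Real.log (τ (u : 𝓞 K)))| / c)) w := by
  have hrank : Units.rank K = 1 := by rw [Units.rank, card_infinitePlace_eq_two h2]
  have : Unique (Fin (Units.rank K)) := by rw [hrank]; infer_instance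
  let e : Units.torsion K × ℤ → (𝓞 K)ˣ := fun z ↦ z.1 * Units.fundSystem K default ^ z.2
  have he : Function.Bijective e := by
    rw [Function.bijective_iff_existsUnique]
    intro u
    obtain ⟨⟨ζ, k⟩, h, huniq⟩ := Units.exist_unique_eq_mul_prod K u
    rw [Fintype.prod_unique] at h
    refine ⟨(ζ, k default), h.symm, fun z hz ↦ ?_⟩
    have h3 := huniq (z.1, fun _ ↦ z.2) (by
      beta_reduce
      rw [Fintype.prod_unique]
      exact hz.symm)
    rw [Prod.mk.injEq] at h3
    exact Prod.ext h3.1 (congrFun h3.2 default)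
  let v : (𝓞 K)ˣ → ℝ := fun u ↦ Real.log (σ (u : 𝓞 K)) - Real.log (τ (u : 𝓞 K))
  have hne : ∀ (ρ : K →+* ℝ) (u : (𝓞 K)ˣ), ρ (u : 𝓞 K) ≠ 0 := fun ρ u ↦
    (map_ne_zero ρ).mpr (RingOfIntegers.coe_ne_zero_iff.mpr u.ne_zero)
  have hvmul : ∀ a b, v (a * b) = v a + v b := fun a b ↦ by
    simp only [v, Units.val_mul, map_mul]
    rw [Real.log_mul (hne σ a) (hne σ b), Real.log_mul (hne τ a) (hne τ b)]
    ring
  let V : (𝓞 K)ˣ →* Multiplicative ℝ :=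
    { toFun := fun u ↦ .ofAdd (v u), map_one' := by simp [v], map_mul' := hvmul }
  have hvpow : ∀ (a : (𝓞 K)ˣ) (k : ℤ), v (a ^ k) = k * v a := fun a k ↦ by
    have := congrArg Multiplicative.toAdd (map_zpow V a k)
    rw [toAdd_zpow, zsmul_eq_mul] at this
    exact this
  have htors : ∀ ζ : Units.torsion K, v ζ = 0 := fun ζ ↦ by
    obtain ⟨k, hk, hζ⟩ := isOfFinOrder_iff_pow_eq_one.mp ((CommGroup.mem_torsion _).mp ζ.2)
    have h3 := hvpow ζ k
    rw [zpow_natCast, hζ] at h3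
    have h4 : v 1 = 0 := by simp [v]
    rw [h4] at h3
    have : (k : ℝ) ≠ 0 := by exact_mod_cast hk.ne'
    simpa [this] using h3.symm
  set η := Units.fundSystem K default with hη
  have hvη : v η ≠ 0 := by
    intro h0
    have h3 := abs_mul_abs_unit hN η
    have h4 : |σ (η : 𝓞 K)| = |τ (η : 𝓞 K)| := by
      refine Real.log_injOn_pos (abs_pos.mpr (hne σ η)) (abs_pos.mpr (hne τ η)) ?_
      rw [Real.log_abs, Real.log_abs]
      exact sub_eq_zero.mp h0
    have h5 : |τ (η : 𝓞 K)| = 1 := by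
      rw [h4] at h3
      nlinarith [abs_nonneg (τ (η : 𝓞 K))]
    have h6 : η ∈ Units.torsion K := by
      rw [Units.mem_torsion]
      intro w
      rcases hw w with h | h
      · rw [h, h4, h5]
      · rw [h, h5]
    have h7 : e (⟨η, h6⟩, 0) = e (1, 1) := by
      simp only [e, zpow_zero, mul_one, zpow_one, OneMemClass.coe_one, one_mul]
      rfl
    exact zero_ne_one (congrArg Prod.snd (he.1 h7))
  refine ⟨|v η|, abs_pos.mpr hvη, Nat.card (Units.torsion K),
    Nat.cast_pos.mpr Nat.card_pos, fun y ↦ ?_⟩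
  rw [← (Equiv.ofBijective e he).hasSum_iff]
  have h3 : ∀ (ζ : Units.torsion K), HasSum (fun k : ℤ ↦ max 0 (1 - |y + v (e (ζ, k))| / |v η|)) 1 := by
    intro ζ
    have h := hasSum_tent_int (y / v η)
    have h' : ∀ k : ℤ, |y + v (e (ζ, k))| / |v η| = |y / v η + k| := fun k ↦ by
      rw [hvmul, htors, hvpow, zero_add, ← abs_div, add_div, mul_div_cancel_right₀ _ hvη]
    simpa only [h'] using h
  have := Fintype.ofFinite (Units.torsion K)
  have hs := (summable_prod_of_nonneg (f := fun z : Units.torsion K × ℤ ↦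
    (max 0 (1 - |y + v (e z)| / |v η|) : ℝ)) fun _ ↦ le_max_left _ _).mpr
      ⟨fun ζ ↦ (h3 ζ).summable, Summable.of_finite⟩
  have h4 := hs.hasSum
  rw [hs.tsum_prod, tsum_congr fun ζ ↦ (h3 ζ).tsum_eq, tsum_fintype, Finset.sum_const,
    Finset.card_univ, nsmul_one, ← Nat.card_eq_fintype_card] at h4
  exact h4

theorem exists_real_embeddings (h2 : Module.finrank ℚ K = 2) [IsTotallyReal K] :
    ∃ σ τ : 𝓞 K →+* ℝ, (∀ x, ((Algebra.norm ℤ x : ℤ) : ℝ) = σ x * τ x) ∧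
      (∀ r : ℝ, 2 < r → Summable fun x ↦ (max |σ x| |τ x|) ^ (-r)) ∧
      ∃ c : ℝ, 0 < c ∧ ∃ w : ℝ, 0 < w ∧ ∀ y : ℝ, HasSum (fun u : (𝓞 K)ˣ ↦
        max 0 (1 - |y + (Real.log (σ u) - Real.log (τ u))| / c)) w := by
  obtain ⟨σ, τ, hN, hw⟩ := exists_pair_embeddings h2
  refine ⟨σ.comp (algebraMap (𝓞 K) K), τ.comp (algebraMap (𝓞 K) K), fun x ↦ ?_,
    fun r hr ↦ summable_max_rpow h2 hw hr, exists_hasSum_units h2 hN hw⟩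
  have := hN x
  rw [← Algebra.coe_norm_int, Rat.cast_intCast] at this
  exact this

end RealQuadratic

section RealPair

open Filter Topology NumberField Ideal
open scoped nonZeroDivisors

/-- The two real embeddings of the ring of integers of a real quadratic field, together with the
consequences of the geometry of numbers used to bound its `L`-series. -/
structure RealPair (K : Type*) [Field K] [NumberField K] where
  /-- the first embedding -/
  σ : 𝓞 K →+* ℝ
  /-- the second embedding -/
  τ : 𝓞 K →+* ℝ
  norm_eq : ∀ x, ((Algebra.norm ℤ x : ℤ) : ℝ) = σ x * τ x
  summable_max : ∀ r : ℝ, 2 < r → Summable fun x ↦ (max |σ x| |τ x|) ^ (-r)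
  /-- the size of a fundamental unit -/
  c : ℝ
  c_pos : 0 < c
  /-- the number of roots of unity -/
  w : ℝ
  w_pos : 0 < w
  hasSum_units : ∀ y : ℝ, HasSum (fun u : (𝓞 K)ˣ ↦
    max 0 (1 - |y + (Real.log (σ u) - Real.log (τ u))| / c)) w

variable {K : Type*} [Field K] [NumberField K]

lemma nonempty_realPair (h2 : Module.finrank ℚ K = 2) [IsTotallyReal K] :
    Nonempty (RealPair K) := by
  obtain ⟨σ, τ, h1, h2, c, hc, w, hw, h3⟩ := exists_real_embeddings h2
  exact ⟨⟨σ, τ, h1, h2, c, hc, w, hw, h3⟩⟩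

namespace RealPair
variable (R : RealPair K)

/-- The height of an algebraic integer. -/
noncomputable def ht (x : 𝓞 K) : ℝ := max |R.σ x| |R.τ x|

/-- The function `|N(x)|^(-s)`, cut off to a neighbourhood of a fundamental domain for the action
of the units. -/
noncomputable def weight (s : ℝ) (x : 𝓞 K) : ℝ := tentPow R.c s (R.σ x) (R.τ x)

lemma weight_nonneg (s : ℝ) (x : 𝓞 K) : 0 ≤ R.weight s x := tentPow_nonneg _ _ _ _

lemma weight_zero {s : ℝ} (hs : 1 < s) : R.weight s 0 = 0 := by
  rw [weight, map_zero, map_zero, tentPow_zero _ hs]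

lemma weight_le_one {s : ℝ} (hs : 1 < s) (x : 𝓞 K) : R.weight s x ≤ 1 := by
  rcases eq_or_ne x 0 with rfl | hx
  · rw [R.weight_zero hs]
    exact zero_le_one
  · refine (tentPow_le R.c_pos s _ _).trans ?_
    rw [← R.norm_eq]
    refine Real.rpow_le_one_of_one_le_of_nonpos ?_ (by linarith)
    exact_mod_cast Int.one_le_abs (Algebra.norm_ne_zero_iff.mpr hx)

lemma summable_weight {s : ℝ} (hs : 1 < s) : Summable (R.weight s) :=
  Summable.of_nonneg_of_le (R.weight_nonneg s) (fun x ↦ tentPow_le_max_rpow R.c_pos hs _ _)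
    ((R.summable_max (2 * s) (by linarith)).mul_left _)

lemma ht_pos {x : 𝓞 K} (hx : x ≠ 0) : 0 < R.ht x := by
  have h : R.σ x * R.τ x ≠ 0 := by
    rw [← R.norm_eq]
    exact_mod_cast Algebra.norm_ne_zero_iff.mpr hx
  exact lt_max_of_lt_left (abs_pos.mpr (left_ne_zero_of_mul h))

lemma ht_natCast_mul (M : ℕ) (x : 𝓞 K) : R.ht (M * x) = M * R.ht x := by
  rw [ht, ht, map_mul, map_mul, map_natCast, map_natCast, abs_mul, abs_mul, Nat.abs_cast,
    mul_max_of_nonneg _ _ (Nat.cast_nonneg _)]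

lemma exists_norm_tsum_weight_sub_le (v : 𝓞 K) {M : ℕ} (hM : 0 < M) :
    ∃ C : ℝ, ∀ s : ℝ, 1 < s → s ≤ 2 →
      |∑' x : 𝓞 K, (R.weight s (v + M * x) - R.weight s (M * x))| ≤ C := by
  classical
  obtain ⟨C, B, hC, hB⟩ := exists_abs_tentPow_add_sub_le R.c_pos (R.σ v) (R.τ v)
  let F : 𝓞 K → ℝ := fun x ↦ (C + |B| ^ 3) * (R.ht x) ^ (-3 : ℝ) + if x = 0 then 1 else 0
  have hF : Summable F := ((R.summable_max 3 (by norm_num)).mul_left _).add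
    (summable_of_ne_finset_zero (s := {0}) fun x hx ↦ if_neg (Finset.notMem_singleton.mp hx))
  refine ⟨∑' x, F x, fun s hs hs' ↦ (Real.norm_eq_abs _).ge.trans
    (tsum_of_norm_bounded hF.hasSum fun x ↦ ?_)⟩
  rw [Real.norm_eq_abs]
  have h1 : |R.weight s (v + M * x) - R.weight s (M * x)| ≤ 1 :=
    abs_sub_le_of_le_of_le (R.weight_nonneg s _) (R.weight_le_one hs _)
      (R.weight_nonneg s _) (R.weight_le_one hs _) |>.trans (by norm_num)
  rcases eq_or_ne x 0 with rfl | hx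
  · refine h1.trans ?_
    simp only [F, if_pos]
    have : 0 ≤ R.ht 0 := le_max_of_le_left (abs_nonneg _)
    exact le_add_of_nonneg_left (by positivity)
  simp only [F, if_neg hx, add_zero]
  have h0 := R.ht_pos hx
  have hle : R.ht x ≤ R.ht (M * x) := by
    rw [R.ht_natCast_mul]
    exact le_mul_of_one_le_left h0.le (by exact_mod_cast hM)
  have h3 : (R.ht x) ^ (-3 : ℝ) = ((R.ht x) ^ 3)⁻¹ := by
    rw [Real.rpow_neg h0.le]
    norm_cast
  rw [h3, add_mul]
  rcases le_or_gt B (R.ht (M * x)) with h | h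
  · have h4 := hB (R.σ (M * x)) (R.τ (M * x)) s hs hs' h
    rw [← map_add, ← map_add, add_comm _ v] at h4
    refine h4.trans (le_add_of_le_of_nonneg ?_ (by positivity))
    exact mul_le_mul_of_nonneg_left (inv_anti₀ (by positivity) (pow_le_pow_left₀ h0.le hle 3)) hC
  · refine h1.trans (le_add_of_nonneg_of_le (by positivity) ?_)
    rw [← div_eq_mul_inv, one_le_div (by positivity)]
    exact pow_le_pow_left₀ h0.le ((hle.trans h.le).trans (le_abs_self B)) 3

/-- A sum of a periodic function with vanishing mean against the weights remains bounded as
`s → 1`. -/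
theorem exists_norm_tsum_mul_weight_le {M : ℕ} (hM : 0 < M) {f : 𝓞 K → ℂ} (hf : ∀ x, ‖f x‖ ≤ 1)
    (hper : ∀ x y, f (x + M * y) = f x) {a : ℤ} (ha : IsCoprime a M) {z : ℂ} (hz : z ≠ 1)
    (hfa : ∀ x, f (a * x) = z * f x) :
    ∃ C : ℝ, ∀ s : ℝ, 1 < s → s ≤ 2 → ‖∑' x, f x * (R.weight s x : ℂ)‖ ≤ C := by
  have hM0 : (M : 𝓞 K) ≠ 0 := Nat.cast_ne_zero.mpr hM.ne'
  set S : Ideal (𝓞 K) := Ideal.span {(M : 𝓞 K)} with hS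
  have hS0 : S ≠ ⊥ := by simpa [hS] using hM0
  have := Ideal.finiteQuotientOfFreeOfNeBot S hS0
  have := Fintype.ofFinite (𝓞 K ⧸ S)
  have hsame : ∀ x y : 𝓞 K, Ideal.Quotient.mk S x = Ideal.Quotient.mk S y → f x = f y := by
    intro x y h
    obtain ⟨t, ht⟩ := Ideal.mem_span_singleton'.mp (Ideal.Quotient.eq.mp h)
    rw [← hper y t, mul_comm, ht, add_sub_cancel]
  let out : 𝓞 K ⧸ S → 𝓞 K := fun q ↦ (Ideal.Quotient.mk_surjective q).choose
  have hout : ∀ q, Ideal.Quotient.mk S (out q) = q :=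
    fun q ↦ (Ideal.Quotient.mk_surjective q).choose_spec
  have hzero : ∑ q, f (out q) = 0 := by
    obtain ⟨r, t, hrt⟩ := ha
    have h1 : ((r : ℤ) : 𝓞 K ⧸ S) * ((a : ℤ) : 𝓞 K ⧸ S) = 1 := by
      have h2 := congrArg (Int.cast : ℤ → 𝓞 K ⧸ S) hrt
      have h3 : ((M : ℕ) : 𝓞 K ⧸ S) = 0 := by
        rw [← map_natCast (Ideal.Quotient.mk S)]
        exact Ideal.Quotient.eq_zero_iff_mem.mpr (Ideal.mem_span_singleton_self _)
      push_cast at h2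
      rwa [h3, mul_zero, add_zero] at h2
    let u : (𝓞 K ⧸ S)ˣ := ⟨a, r, by rw [mul_comm, h1], h1⟩
    have h2 : ∑ q, f (out q) = z * ∑ q, f (out q) := by
      rw [Finset.mul_sum]
      refine (Fintype.sum_equiv u.mulLeft _ _ fun q ↦ ?_).symm
      rw [← hfa]
      refine hsame _ _ ?_
      rw [hout, map_mul, hout, map_intCast]
      rfl
    have h3 : (z - 1) * ∑ q, f (out q) = 0 := by linear_combination -h2
    exact (mul_eq_zero.mp h3).resolve_left (sub_ne_zero.mpr hz)
  let e : (𝓞 K ⧸ S) × 𝓞 K → 𝓞 K := fun p ↦ out p.1 + M * p.2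
  have hemk : ∀ p, Ideal.Quotient.mk S (e p) = p.1 := fun p ↦ by
    have : Ideal.Quotient.mk S (M * p.2 : 𝓞 K) = 0 :=
      Ideal.Quotient.eq_zero_iff_mem.mpr (Ideal.mem_span_singleton'.mpr ⟨p.2, mul_comm _ _⟩)
    rw [map_add, hout, this, add_zero]
  have he : Function.Bijective e := by
    constructor
    · rintro ⟨q, x⟩ ⟨q', x'⟩ h
      obtain rfl : q = q' := by
        have := congrArg (Ideal.Quotient.mk S) h
        rwa [hemk, hemk] at this
      exact Prod.ext rfl (mul_left_cancel₀ hM0 (add_left_cancel h))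
    · intro x
      obtain ⟨t, ht⟩ := Ideal.mem_span_singleton'.mp (Ideal.Quotient.eq.mp
        (hout (Ideal.Quotient.mk S x)).symm)
      refine ⟨(Ideal.Quotient.mk S x, t), ?_⟩
      simp only [e]
      rw [mul_comm, ht, add_sub_cancel]
  choose C hC using fun v ↦ R.exists_norm_tsum_weight_sub_le v hM
  refine ⟨∑ q, C (out q), fun s hs hs' ↦ ?_⟩
  have hsum : Summable fun x ↦ f x * (R.weight s x : ℂ) := by
    refine Summable.of_norm_bounded (R.summable_weight hs) fun x ↦ ?_
    rw [norm_mul, Complex.norm_real, Real.norm_of_nonneg (R.weight_nonneg s x)]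
    exact mul_le_of_le_one_left (R.weight_nonneg s x) (hf x)
  have hinj : Function.Injective fun x : 𝓞 K ↦ (M : 𝓞 K) * x := mul_right_injective₀ hM0
  have hs0 : Summable fun x : 𝓞 K ↦ R.weight s (M * x) :=
    (R.summable_weight hs).comp_injective hinj
  have hs1 : ∀ v, Summable fun x : 𝓞 K ↦ R.weight s (v + M * x) := fun v ↦
    (R.summable_weight hs).comp_injective ((add_right_injective v).comp hinj)
  have hsum' := (Equiv.ofBijective e he).summable_iff.mpr hsum
  rw [← (Equiv.ofBijective e he).tsum_eq]
  refine (congrArg norm (hsum'.tsum_prod.trans (tsum_fintype _))).le.trans ?_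
  have h1 : ∀ q, ∑' x, f (e (q, x)) * (R.weight s (e (q, x)) : ℂ) = f (out q) *
      ((∑' x : 𝓞 K, (R.weight s (out q + M * x) - R.weight s (M * x)) : ℝ) : ℂ) +
      f (out q) * ((∑' x : 𝓞 K, R.weight s (M * x) : ℝ) : ℂ) := fun q ↦ by
    rw [(hs1 _).tsum_sub hs0, ← mul_add, ← Complex.ofReal_add, sub_add_cancel, Complex.ofReal_tsum,
      ← tsum_mul_left]
    refine tsum_congr fun x ↦ ?_
    rw [hper]
  refine (congrArg norm (Finset.sum_congr rfl fun q _ ↦ h1 q)).le.trans ?_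
  rw [Finset.sum_add_distrib, ← Finset.sum_mul, hzero, zero_mul, add_zero]
  refine norm_sum_le_of_le _ fun q _ ↦ ?_
  rw [norm_mul, Complex.norm_real]
  exact (mul_le_of_le_one_left (norm_nonneg _) (hf _)).trans (hC _ s hs hs')

end RealPair
end RealPair

section RayBound

open Filter Topology NumberField Ideal
open scoped nonZeroDivisors

variable {K : Type*} [Field K] [NumberField K]
namespace RealPair

lemma norm_add_natCast_mul (R : RealPair K) (m : ℕ) (x y : 𝓞 K) :
    Algebra.norm ℤ (x + m * y) = Algebra.norm ℤ x +
      m * (Algebra.norm ℤ (x + y) - Algebra.norm ℤ x - Algebra.norm ℤ y +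
        m * Algebra.norm ℤ y) := by
  have : ((Algebra.norm ℤ (x + m * y) : ℤ) : ℝ) = ((Algebra.norm ℤ x +
      m * (Algebra.norm ℤ (x + y) - Algebra.norm ℤ x - Algebra.norm ℤ y +
        m * Algebra.norm ℤ y) : ℤ) : ℝ) := by
    push_cast
    simp only [R.norm_eq, map_add, map_mul, map_natCast]
    ring
  exact_mod_cast this

lemma norm_intCast_mul (R : RealPair K) (a : ℤ) (x : 𝓞 K) :
    Algebra.norm ℤ (a * x) = a ^ 2 * Algebra.norm ℤ x := by
  have : ((Algebra.norm ℤ (a * x) : ℤ) : ℝ) = ((a ^ 2 * Algebra.norm ℤ x : ℤ) : ℝ) := by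
    simp only [Int.cast_mul, Int.cast_pow, R.norm_eq, map_mul, map_intCast]
    ring
  exact_mod_cast this

open scoped Classical in
/-- The function `x ↦ χ(N(x) / N(J))` on the ideal `J`, extended by zero. -/
noncomputable def idealChar {n : ℕ} (χ : DirichletCharacter ℂ n) (J : Ideal (𝓞 K)) (x : 𝓞 K) : ℂ :=
  if x ∈ J then χ ((Algebra.norm ℤ x / (absNorm J : ℤ) : ℤ) : ZMod n) else 0

lemma norm_idealChar_le {n : ℕ} (χ : DirichletCharacter ℂ n) (J : Ideal (𝓞 K)) (x : 𝓞 K) :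
    ‖idealChar χ J x‖ ≤ 1 := by
  rw [idealChar]
  split_ifs
  · exact χ.norm_le_one _
  · simp

lemma natCast_mul_absNorm_mul_mem (n : ℕ) (J : Ideal (𝓞 K)) (x : 𝓞 K) :
    ((n * absNorm J : ℕ) : 𝓞 K) * x ∈ J := by
  push_cast
  exact J.mul_mem_right _ (J.mul_mem_left _ (absNorm_mem J))

lemma idealChar_add (R : RealPair K) {n : ℕ} (χ : DirichletCharacter ℂ n) {J : Ideal (𝓞 K)} (hJ : J ≠ 0)
    (x y : 𝓞 K) : idealChar χ J (x + (n * absNorm J : ℕ) * y) = idealChar χ J x := by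
  have hmem := natCast_mul_absNorm_mul_mem n J y
  rw [idealChar, idealChar]
  by_cases hx : x ∈ J
  · rw [if_pos hx, if_pos (J.add_mem hx hmem)]
    congr 1
    rw [R.norm_add_natCast_mul]
    have hb : (absNorm J : ℤ) ≠ 0 := by exact_mod_cast absNorm_eq_zero_iff.not.mpr hJ
    push_cast
    rw [mul_comm (n : ℤ), mul_assoc, Int.add_mul_ediv_left _ _ hb]
    simp
  · rw [if_neg hx, if_neg ((J.add_mem_iff_left hmem).not.mpr hx)]

lemma idealChar_intCast_mul (R : RealPair K) {n : ℕ} (χ : DirichletCharacter ℂ n) {J : Ideal (𝓞 K)}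
    {a : ℤ} (ha : IsCoprime a ((n * absNorm J : ℕ) : ℤ)) (x : 𝓞 K) :
    idealChar χ J (a * x) = χ a ^ 2 * idealChar χ J x := by
  rw [idealChar, idealChar]
  by_cases hx : x ∈ J
  · rw [if_pos hx, if_pos (J.mul_mem_left _ hx), R.norm_intCast_mul,
      Int.mul_ediv_assoc _ (absNorm_dvd_norm_of_mem hx)]
    simp
  · rw [if_neg hx, if_neg, mul_zero]
    intro hax
    refine hx ?_
    obtain ⟨r, t, hrt⟩ := ha
    have h1 : (r : 𝓞 K) * (a * x) + t * ((n * absNorm J : ℕ) * x) = x := by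
      have h2 := congrArg (Int.cast : ℤ → 𝓞 K) hrt
      push_cast at h2 ⊢
      linear_combination x * h2
    rw [← h1]
    exact J.add_mem (J.mul_mem_left _ hax) (J.mul_mem_left _ (natCast_mul_absNorm_mul_mem n J x))

lemma exists_norm_tsum_idealChar_le (R : RealPair K) {n : ℕ} [NeZero n] {χ : DirichletCharacter ℂ n}
    {u : (ZMod n)ˣ} (hu : χ u ^ 2 ≠ 1) {J : Ideal (𝓞 K)} (hJ : J ≠ 0) :
    ∃ C : ℝ, ∀ s : ℝ, 1 < s → s ≤ 2 →
      ‖∑' x, idealChar χ J x * (R.weight s x : ℂ)‖ ≤ C := by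
  have hb : absNorm J ≠ 0 := absNorm_eq_zero_iff.not.mpr hJ
  have hM : n * absNorm J ≠ 0 := mul_ne_zero (NeZero.ne n) hb
  have : NeZero (n * absNorm J) := ⟨hM⟩
  have hdvd : n ∣ n * absNorm J := dvd_mul_right _ _
  obtain ⟨v, hv⟩ := ZMod.unitsMap_surjective hdvd u
  have hcop : IsCoprime (((v : ZMod (n * absNorm J)).val : ℕ) : ℤ) ((n * absNorm J : ℕ) : ℤ) :=
    Nat.isCoprime_iff_coprime.mpr (ZMod.val_coe_unit_coprime v)
  have hval : ((((v : ZMod (n * absNorm J)).val : ℕ) : ℤ) : ZMod n) = u := by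
    rw [← hv, ZMod.unitsMap_val, Int.cast_natCast, ZMod.natCast_val]
  refine R.exists_norm_tsum_mul_weight_le (Nat.pos_of_ne_zero hM) (norm_idealChar_le χ J)
    (R.idealChar_add χ hJ) hcop hu fun x ↦ ?_
  rw [R.idealChar_intCast_mul χ hcop, hval]

lemma hasSum_weight_units (R : RealPair K) {s : ℝ} {x : 𝓞 K} (hx : x ≠ 0) :
    HasSum (fun u : (𝓞 K)ˣ ↦ R.weight s (x * u))
      (R.w * |((Algebra.norm ℤ x : ℤ) : ℝ)| ^ (-s)) := by
  have hne : ∀ y : 𝓞 K, y ≠ 0 → R.σ y ≠ 0 ∧ R.τ y ≠ 0 := fun y hy ↦ by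
    have h : R.σ y * R.τ y ≠ 0 := by
      rw [← R.norm_eq]
      exact_mod_cast Algebra.norm_ne_zero_iff.mpr hy
    exact ⟨left_ne_zero_of_mul h, right_ne_zero_of_mul h⟩
  have h1 := (R.hasSum_units (Real.log (R.σ x) - Real.log (R.τ x))).mul_right
    (|((Algebra.norm ℤ x : ℤ) : ℝ)| ^ (-s))
  have h2 : ∀ u : (𝓞 K)ˣ, R.weight s (x * u) =
      max 0 (1 - |Real.log (R.σ x) - Real.log (R.τ x) +
        (Real.log (R.σ u) - Real.log (R.τ u))| / R.c) * |((Algebra.norm ℤ x : ℤ) : ℝ)| ^ (-s) := by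
    intro u
    have h3 : |R.σ u * R.τ u| = 1 := by
      rw [← R.norm_eq]
      have := Int.isUnit_iff_abs_eq.mp (u.isUnit.map (Algebra.norm ℤ))
      exact_mod_cast this
    rw [weight, tentPow, tent, map_mul, map_mul, Real.log_mul (hne x hx).1 (hne u u.ne_zero).1,
      Real.log_mul (hne x hx).2 (hne u u.ne_zero).2, R.norm_eq]
    congr 2
    · ring_nf
    · rw [mul_mul_mul_comm, abs_mul, h3, mul_one]
  simpa only [h2] using h1

/-- The sum of `χ(N(I)) N(I)^(-s)` over the ideals of a class, as a sum over elements of an ideal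
in the inverse class. -/
lemma tsum_idealChar_mul_weight (R : RealPair K) {n : ℕ} {χ : DirichletCharacter ℂ n} (hχ : χ.Even)
    {J : (Ideal (𝓞 K))⁰} {C : ClassGroup (𝓞 K)} (hJC : ClassGroup.mk0 J = C⁻¹) {s : ℝ}
    (hs : 1 < s) :
    ∑' x, idealChar χ (J : Ideal (𝓞 K)) x * (R.weight s x : ℂ) =
      ((R.w * (absNorm (J : Ideal (𝓞 K)) : ℝ) ^ (-s) : ℝ) : ℂ) *
      ∑' I : {I : (Ideal (𝓞 K))⁰ // ClassGroup.mk0 I = C},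
        χ (absNorm (I.1 : Ideal (𝓞 K))) * ((absNorm (I.1 : Ideal (𝓞 K)) : ℝ) ^ (-s) : ℝ) := by
  have hJ0 : (J : Ideal (𝓞 K)) ≠ 0 := nonZeroDivisors.coe_ne_zero J
  have hb : (absNorm (J : Ideal (𝓞 K)) : ℤ) ≠ 0 := by
    exact_mod_cast absNorm_eq_zero_iff.not.mpr hJ0
  have hprin : ∀ I : {I : (Ideal (𝓞 K))⁰ // ClassGroup.mk0 I = C},
      ∃ α : 𝓞 K, Ideal.span {α} = (I.1 : Ideal (𝓞 K)) * J := fun I ↦ by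
    have h : ClassGroup.mk0 (I.1 * J) = 1 := by rw [map_mul, I.2, hJC, mul_inv_cancel]
    obtain ⟨α, hα⟩ := ((ClassGroup.mk0_eq_one_iff _).mp h).principal
    exact ⟨α, hα.symm⟩
  choose α hα using hprin
  have hα0 : ∀ I, α I ≠ 0 := fun I h ↦ by
    have := hα I
    rw [h, Ideal.span_singleton_eq_bot.mpr rfl] at this
    exact mul_ne_zero (nonZeroDivisors.coe_ne_zero I.1) hJ0 this.symm
  have hspan : ∀ I (u : (𝓞 K)ˣ), Ideal.span {α I * u} = (I.1 : Ideal (𝓞 K)) * J := fun I u ↦ by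
    rw [← hα, Ideal.span_singleton_mul_right_unit u.isUnit]
  let Φ : {I : (Ideal (𝓞 K))⁰ // ClassGroup.mk0 I = C} × (𝓞 K)ˣ → 𝓞 K := fun p ↦ α p.1 * p.2
  have hΦ : Function.Injective Φ := by
    rintro ⟨I, u⟩ ⟨I', u'⟩ h
    obtain rfl : I = I' := by
      have h1 : (I.1 : Ideal (𝓞 K)) * J = (I'.1 : Ideal (𝓞 K)) * J := by
        rw [← hspan I u, ← hspan I' u']
        exact congrArg (fun z ↦ Ideal.span {z}) h
      exact Subtype.ext (Subtype.ext (mul_right_cancel₀ hJ0 h1))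
    exact Prod.ext rfl (Units.ext (mul_left_cancel₀ (hα0 I) h))
  have hsupp : (Function.support fun x ↦ idealChar χ (J : Ideal (𝓞 K)) x * (R.weight s x : ℂ)) ⊆
      Set.range Φ := by
    intro x hx
    obtain ⟨h1, h2⟩ := mul_ne_zero_iff.mp hx
    have hxJ : x ∈ (J : Ideal (𝓞 K)) := by
      by_contra h
      exact h1 (if_neg h)
    have hx0 : x ≠ 0 := by
      rintro rfl
      exact h2 (by rw [R.weight_zero hs, Complex.ofReal_zero])
    obtain ⟨I, hI⟩ := Ideal.dvd_iff_le.mpr ((Ideal.span_singleton_le_iff_mem _).mpr hxJ)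
    have hI0 : I ≠ 0 := by
      rintro rfl
      rw [mul_zero] at hI
      exact hx0 (Ideal.span_singleton_eq_bot.mp hI)
    let I' : (Ideal (𝓞 K))⁰ := ⟨I, mem_nonZeroDivisors_of_ne_zero hI0⟩
    have hIC : ClassGroup.mk0 I' = C := by
      have h3 : ClassGroup.mk0 (J * I') = 1 :=
        (ClassGroup.mk0_eq_one_iff _).mpr ⟨x, hI.symm⟩
      rw [map_mul, hJC] at h3
      exact (inv_mul_eq_one.mp h3).symm
    have h4 : Ideal.span {α ⟨I', hIC⟩} = Ideal.span {x} := by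
      rw [hα, hI, mul_comm]
    obtain ⟨u, hu⟩ := Ideal.span_singleton_eq_span_singleton.mp h4
    exact ⟨(⟨I', hIC⟩, u), hu⟩
  have hsum : Summable fun x ↦ idealChar χ (J : Ideal (𝓞 K)) x * (R.weight s x : ℂ) := by
    refine Summable.of_norm_bounded (R.summable_weight hs) fun x ↦ ?_
    rw [norm_mul, Complex.norm_real, Real.norm_of_nonneg (R.weight_nonneg s x)]
    exact mul_le_of_le_one_left (R.weight_nonneg s x) (norm_idealChar_le χ _ x)
  rw [← hΦ.tsum_eq hsupp]
  refine (hsum.comp_injective hΦ).tsum_prod.trans ?_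
  rw [← tsum_mul_left]
  refine tsum_congr fun I ↦ ?_
  have hnorm : ∀ u : (𝓞 K)ˣ, (Algebra.norm ℤ (α I * u)).natAbs =
      absNorm (I.1 : Ideal (𝓞 K)) * absNorm (J : Ideal (𝓞 K)) := fun u ↦ by
    rw [← absNorm_span_singleton, hspan, map_mul]
  have hchar : ∀ u : (𝓞 K)ˣ, idealChar χ (J : Ideal (𝓞 K)) (α I * u) =
      χ (absNorm (I.1 : Ideal (𝓞 K))) := fun u ↦ by
    have hmem : α I * u ∈ (J : Ideal (𝓞 K)) := by
      have h : α I * u ∈ (I.1 : Ideal (𝓞 K)) * J := by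
        rw [← hspan I u]
        exact Ideal.mem_span_singleton_self _
      exact Ideal.mul_le_right h
    rw [idealChar, if_pos hmem]
    rcases Int.natAbs_eq (Algebra.norm ℤ (α I * u)) with h | h
    · rw [h, hnorm, Nat.cast_mul, Int.mul_ediv_cancel _ hb, Int.cast_natCast]
    · rw [h, hnorm, Nat.cast_mul, ← neg_mul, Int.mul_ediv_cancel _ hb, Int.cast_neg,
        Int.cast_natCast, hχ.eval_neg]
  have hw := (R.hasSum_weight_units (s := s) (hα0 I)).tsum_eq
  have habs : |((Algebra.norm ℤ (α I) : ℤ) : ℝ)| =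
      absNorm (I.1 : Ideal (𝓞 K)) * absNorm (J : Ideal (𝓞 K)) := by
    have := hnorm 1
    rw [Units.val_one, mul_one] at this
    rw [← Int.cast_abs, Int.abs_eq_natAbs, this]
    push_cast
    rfl
  rw [habs, Real.mul_rpow (Nat.cast_nonneg _) (Nat.cast_nonneg _)] at hw
  change ∑' u : (𝓞 K)ˣ, idealChar χ (J : Ideal (𝓞 K)) (α I * u) * (R.weight s (α I * u) : ℂ) = _
  simp only [hchar]
  rw [tsum_mul_left, ← Complex.ofReal_tsum, hw]
  push_cast
  ring

/-- The `L`-series of the character `I ↦ χ(N(I)) ψ([I])` is bounded near `s = 1` when `χ ^ 2` is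
nontrivial. -/
theorem exists_norm_tsum_rayTerm_le (R : RealPair K) {n : ℕ} [NeZero n] {χ : DirichletCharacter ℂ n}
    (hχ : χ.Even) {u : (ZMod n)ˣ} (hu : χ u ^ 2 ≠ 1) (ψ : ClassGroup (𝓞 K) →* ℂ) :
    ∃ C : ℝ, ∀ s : ℝ, 1 < s → s ≤ 2 → ‖∑' I : Ideal (𝓞 K), rayTerm χ ψ s I‖ ≤ C := by
  choose J hJ using fun C : ClassGroup (𝓞 K) ↦ ClassGroup.mk0_surjective C⁻¹
  choose B hB using fun C ↦
    R.exists_norm_tsum_idealChar_le hu (nonZeroDivisors.coe_ne_zero (J C))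
  refine ⟨∑ C, (R.w)⁻¹ * (absNorm (J C : Ideal (𝓞 K)) : ℝ) ^ 2 * B C, fun s hs hs' ↦ ?_⟩
  simp only [rayTerm_apply]
  rw [tsum_classTerm ψ hs (fun k ↦ χ k) fun k ↦ χ.norm_le_one _]
  refine norm_sum_le_of_le _ fun C _ ↦ ?_
  have h1 := hB C s hs hs'
  have hb : (1 : ℝ) ≤ absNorm (J C : Ideal (𝓞 K)) := by
    exact_mod_cast absNorm_pos_of_nonZeroDivisors K (J C)
  have hw := R.w_pos
  rw [R.tsum_idealChar_mul_weight hχ (hJ C) hs, norm_mul, Complex.norm_real,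
    Real.norm_of_nonneg (by positivity)] at h1
  rw [norm_mul, norm_classChar_eq_one, one_mul]
  have h3 : R.w * ((absNorm (J C : Ideal (𝓞 K)) : ℝ) ^ 2)⁻¹ ≤
      R.w * (absNorm (J C : Ideal (𝓞 K)) : ℝ) ^ (-s) := by
    gcongr
    rw [← Real.rpow_two, ← Real.rpow_neg (by positivity)]
    exact Real.rpow_le_rpow_of_exponent_le hb (by linarith)
  have h4 := (mul_le_mul_of_nonneg_right h3 (norm_nonneg _)).trans h1
  rw [← div_eq_mul_inv, div_mul_eq_mul_div, div_le_iff₀ (by positivity)] at h4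
  rw [mul_assoc, inv_mul_eq_div, le_div_iff₀' hw, mul_comm (_ ^ 2)]
  exact h4

end RealPair
end RayBound

section NormSurjective

open Filter Topology NumberField Ideal IsDedekindDomain
open scoped nonZeroDivisors

/-- Comparison of sums along a map with fibres of bounded cardinality. -/
lemma summable_and_tsum_le_of_fibers {α β : Type*} {g : α → β} {d : ℕ}
    (hg : ∀ (T : Finset α) (b : β), (∀ a ∈ T, g a = b) → T.card ≤ d) {f : α → ℝ} {h : β → ℝ}
    (hf : ∀ a, 0 ≤ f a) (hfh : ∀ a, f a ≤ h (g a)) (h0 : ∀ b, 0 ≤ h b) (hh : Summable h) :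
    Summable f ∧ ∑' a, f a ≤ d * ∑' b, h b := by
  classical
  have hbound : ∀ T : Finset α, ∑ a ∈ T, f a ≤ d * ∑' b, h b := by
    intro T
    calc ∑ a ∈ T, f a ≤ ∑ a ∈ T, h (g a) := Finset.sum_le_sum fun a _ ↦ hfh a
      _ = ∑ b ∈ T.image g, (T.filter fun a ↦ g a = b).card • h b := Finset.sum_comp h g
      _ ≤ ∑ b ∈ T.image g, d * h b := by
        refine Finset.sum_le_sum fun b _ ↦ ?_
        rw [nsmul_eq_mul]
        refine mul_le_mul_of_nonneg_right ?_ (h0 b)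
        exact_mod_cast hg _ b fun a ha ↦ (Finset.mem_filter.mp ha).2
      _ = d * ∑ b ∈ T.image g, h b := by rw [Finset.mul_sum]
      _ ≤ d * ∑' b, h b := by
        gcongr
        exact hh.sum_le_tsum _ fun b _ ↦ h0 b
  exact ⟨summable_of_sum_le hf hbound, Real.tsum_le_of_sum_le hf hbound⟩

section Primes

variable {K L : Type*} [Field K] [NumberField K] [Field L] [NumberField L] [Algebra K L]

lemma card_le_finrank_of_under_eq (P : HeightOneSpectrum (𝓞 K))
    (T : Finset (HeightOneSpectrum (𝓞 L)))
    (hT : ∀ Q ∈ T, HeightOneSpectrum.under (𝓞 K) Q = P) : T.card ≤ Module.finrank K L := by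
  classical
  have := Fintype.ofFinite (P.asIdeal.primesOver (𝓞 L))
  have h1 := Ideal.sum_ramification_inertia_eq_finrank P.asIdeal (𝓞 L)
  rw [IsFractionRing.finrank_eq (𝓞 K) K (𝓞 L) L, ← h1]
  calc T.card ≤ Fintype.card (P.asIdeal.primesOver (𝓞 L)) := by
        rw [← Fintype.card_coe]
        refine Fintype.card_le_of_injective (fun Q : T ↦ ⟨Q.1.asIdeal, Q.1.isPrime, ⟨?_⟩⟩) ?_
        · rw [← hT Q.1 Q.2]
          rfl
        · intro Q Q' h
          exact Subtype.ext (HeightOneSpectrum.ext (congrArg Subtype.val h))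
    _ = ∑ q : P.asIdeal.primesOver (𝓞 L), 1 := by simp
    _ ≤ _ := by
      refine Finset.sum_le_sum fun q _ ↦ ?_
      have := q.2.1
      exact Nat.one_le_iff_ne_zero.mpr
        (mul_pos (Ideal.ramificationIdx_pos _ _) (Ideal.inertiaDeg_pos _ _)).ne'

lemma exists_absNorm_eq_pow (Q : HeightOneSpectrum (𝓞 L)) :
    ∃ f : ℕ, f ≠ 0 ∧
      Ideal.relNorm (𝓞 K) Q.asIdeal = (HeightOneSpectrum.under (𝓞 K) Q).asIdeal ^ f ∧
      absNorm Q.asIdeal = absNorm (HeightOneSpectrum.under (𝓞 K) Q).asIdeal ^ f := by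
  have : Q.asIdeal.LiesOver (HeightOneSpectrum.under (𝓞 K) Q).asIdeal := ⟨rfl⟩
  have h := relNorm_eq_pow_of_isMaximal Q.asIdeal (HeightOneSpectrum.under (𝓞 K) Q).asIdeal
  refine ⟨_, (Ideal.inertiaDeg_pos _ _).ne', h, ?_⟩
  rw [← map_pow, ← h, absNorm_relNorm]

/-- Up to a bounded error, the sum of `N(Q)^(-s)` over all primes `Q` of `L` comes from the primes
of relative degree one. -/
lemma exists_tsum_absNorm_le (S : Set (HeightOneSpectrum (𝓞 K)))
    (hS : {Q : HeightOneSpectrum (𝓞 L) |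
      absNorm Q.asIdeal = absNorm (HeightOneSpectrum.under (𝓞 K) Q).asIdeal ∧
        HeightOneSpectrum.under (𝓞 K) Q ∉ S}.Finite) :
    ∃ C : ℝ, ∀ s : ℝ, 1 < s → ∑' Q : HeightOneSpectrum (𝓞 L), (absNorm Q.asIdeal : ℝ) ^ (-s) ≤
      Module.finrank K L *
        ∑' P : HeightOneSpectrum (𝓞 K), S.indicator (fun P ↦ (absNorm P.asIdeal : ℝ) ^ (-s)) P +
      C := by
  classical
  refine ⟨Module.finrank K L * primeSqSum K + hS.toFinset.card, fun s hs ↦ ?_⟩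
  set E := hS.toFinset with hE
  let f : HeightOneSpectrum (𝓞 L) → ℝ := fun Q ↦
    if Q ∈ E then 0 else (absNorm Q.asIdeal : ℝ) ^ (-s)
  let e : HeightOneSpectrum (𝓞 L) → ℝ := fun Q ↦ if Q ∈ E then 1 else 0
  have hs1 : Summable fun P : HeightOneSpectrum (𝓞 K) ↦
      S.indicator (fun P ↦ (absNorm P.asIdeal : ℝ) ^ (-s)) P :=
    (summable_prime_absNorm hs).indicator S
  have hs2 : Summable fun P : HeightOneSpectrum (𝓞 K) ↦ (absNorm P.asIdeal : ℝ) ^ (-2 : ℝ) :=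
    summable_prime_absNorm one_lt_two
  have h0 : ∀ P : HeightOneSpectrum (𝓞 K),
      0 ≤ S.indicator (fun P ↦ (absNorm P.asIdeal : ℝ) ^ (-s)) P := fun P ↦
    Set.indicator_nonneg (fun _ _ ↦ by positivity) P
  have hf : ∀ Q, 0 ≤ f Q := fun Q ↦ by
    simp only [f]
    split_ifs <;> positivity
  have hfh : ∀ Q, f Q ≤ S.indicator (fun P ↦ (absNorm P.asIdeal : ℝ) ^ (-s))
      (HeightOneSpectrum.under (𝓞 K) Q) +
        (absNorm (HeightOneSpectrum.under (𝓞 K) Q).asIdeal : ℝ) ^ (-2 : ℝ) := by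
    intro Q
    set P := HeightOneSpectrum.under (𝓞 K) Q with hP
    have h2 : 0 ≤ (absNorm P.asIdeal : ℝ) ^ (-2 : ℝ) := by positivity
    simp only [f]
    split_ifs with hQ
    · exact add_nonneg (h0 _) h2
    · by_cases h : absNorm Q.asIdeal = absNorm P.asIdeal
      · have hPS : P ∈ S := by
          by_contra h3
          exact hQ (hS.mem_toFinset.mpr ⟨h, h3⟩)
        rw [Set.indicator_of_mem hPS, h]
        exact le_add_of_nonneg_right h2
      · refine le_add_of_nonneg_of_le (h0 _) ?_
        obtain ⟨k, hk0, -, hk⟩ := exists_absNorm_eq_pow (K := K) Q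
        rw [← hP] at hk
        have hk2 : 2 ≤ k := by
          by_contra h3
          obtain rfl : k = 1 := by omega
          exact h (by rw [hk, pow_one])
        have hN : (1 : ℝ) ≤ absNorm P.asIdeal := by
          exact_mod_cast (one_le_two.trans (two_le_absNorm P))
        rw [hk, Nat.cast_pow, ← Real.rpow_natCast, ← Real.rpow_mul (by positivity)]
        refine Real.rpow_le_rpow_of_exponent_le hN ?_
        have : (2 : ℝ) ≤ k := by exact_mod_cast hk2
        nlinarith
  obtain ⟨hfs, hle⟩ := summable_and_tsum_le_of_fibers
    (fun T P hT ↦ card_le_finrank_of_under_eq (K := K) P T hT) hf hfh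
    (fun P ↦ add_nonneg (h0 P) (by positivity)) (hs1.add hs2)
  rw [hs1.tsum_add hs2] at hle
  have hes : HasSum e E.card := by
    have h : HasSum e (∑ Q ∈ E, e Q) := hasSum_sum_of_ne_finset_zero fun Q hQ ↦ if_neg hQ
    rwa [Finset.sum_congr rfl fun Q hQ ↦ if_pos hQ, Finset.sum_const, nsmul_one] at h
  have hle2 : ∑' Q : HeightOneSpectrum (𝓞 L), (absNorm Q.asIdeal : ℝ) ^ (-s) ≤
      ∑' Q, (f Q + e Q) := by
    refine (summable_prime_absNorm hs).tsum_le_tsum (fun Q ↦ ?_) (hfs.add hes.summable)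
    simp only [f, e]
    split_ifs
    · rw [zero_add]
      refine Real.rpow_le_one_of_one_le_of_nonpos ?_ (by linarith)
      exact_mod_cast (one_le_two.trans (two_le_absNorm Q))
    · rw [add_zero]
  rw [hfs.tsum_add hes.summable, hes.tsum_eq] at hle2
  change ∑' Q, f Q ≤ Module.finrank K L * (_ + primeSqSum K) at hle
  linarith

end Primes

section Lower

variable {K : Type*} [Field K] [NumberField K]

lemma re_classTerm_one (s : ℝ) (P : HeightOneSpectrum (𝓞 K)) :
    (classTerm 1 s P.asIdeal).re = (absNorm P.asIdeal : ℝ) ^ (-s) := by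
  have := classTerm_coe 1 s ⟨P.asIdeal, mem_nonZeroDivisors_of_ne_zero P.ne_bot⟩
  rw [this, MonoidHom.one_apply, one_mul, Complex.ofReal_re]

lemma exists_eventually_le_exp_tsum :
    ∃ c : ℝ, 0 < c ∧ ∀ᶠ s : ℝ in 𝓝[>] 1, c ≤ (s - 1) *
      Real.exp (∑' P : HeightOneSpectrum (𝓞 K), (absNorm P.asIdeal : ℝ) ^ (-s)) := by
  have hres := dedekindZeta_residue_pos K
  refine ⟨dedekindZeta_residue K / 2 / Real.exp (primeSqSum K), by positivity, ?_⟩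
  filter_upwards [(tendsto_sub_one_mul_tsum_classTerm_one (K := K)).eventually_const_le
    (half_lt_self hres), self_mem_nhdsWithin] with s h1 (hs : 1 < s)
  have h2 := (norm_tsum_bounds hs (norm_classTerm_le (K := K) 1 s)).2
  simp only [re_classTerm_one] at h2
  rw [div_le_iff₀ (by positivity)]
  refine h1.trans ?_
  rw [mul_right_comm, mul_assoc, mul_comm (Real.exp _)]
  rw [mul_comm (Real.exp _)] at h2
  exact mul_le_mul_of_nonneg_left h2 (by linarith)

end Lower

section Upper

variable {K : Type*} [Field K] [NumberField K] {n : ℕ}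

lemma summable_re_rayTerm (χ : DirichletCharacter ℂ n) (ψ : ClassGroup (𝓞 K) →* ℂ) {s : ℝ}
    (hs : 1 < s) : Summable fun P : HeightOneSpectrum (𝓞 K) ↦ (rayTerm χ ψ s P.asIdeal).re :=
  Complex.reCLM.summable (Summable.of_norm_bounded (summable_prime_absNorm hs)
    fun P ↦ norm_rayTerm_le χ ψ s P.asIdeal)

lemma summable_re_classTerm (ψ : ClassGroup (𝓞 K) →* ℂ) {s : ℝ} (hs : 1 < s) :
    Summable fun P : HeightOneSpectrum (𝓞 K) ↦ (classTerm ψ s P.asIdeal).re :=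
  Complex.reCLM.summable (Summable.of_norm_bounded (summable_prime_absNorm hs)
    fun P ↦ norm_classTerm_le ψ s P.asIdeal)

lemma RealPair.exists_tsum_re_rayTerm_le (R : RealPair K) [NeZero n] {χ : DirichletCharacter ℂ n}
    (hχ : χ.Even) {u : (ZMod n)ˣ} (hu : χ u ^ 2 ≠ 1) (ψ : ClassGroup (𝓞 K) →* ℂ) :
    ∃ C : ℝ, ∀ s : ℝ, 1 < s → s ≤ 2 →
      ∑' P : HeightOneSpectrum (𝓞 K), (rayTerm χ ψ s P.asIdeal).re ≤ C := by
  obtain ⟨C, hC⟩ := R.exists_norm_tsum_rayTerm_le hχ hu ψ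
  refine ⟨Real.exp (primeSqSum K) * C, fun s hs hs' ↦ ?_⟩
  have h1 := (norm_tsum_bounds hs (norm_rayTerm_le (K := K) χ ψ s)).1
  have h2 := Real.add_one_le_exp (∑' P : HeightOneSpectrum (𝓞 K), (rayTerm χ ψ s P.asIdeal).re)
  have h3 := mul_le_mul_of_nonneg_left (hC s hs hs') (Real.exp_pos (primeSqSum K)).le
  linarith

lemma finite_setOf_not_isUnit_absNorm [NeZero n] :
    {P : HeightOneSpectrum (𝓞 K) | ¬ IsUnit (absNorm P.asIdeal : ZMod n)}.Finite := by
  have hn : Ideal.span {(n : 𝓞 K)} ≠ 0 := by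
    rw [Ne, Ideal.zero_eq_bot, Ideal.span_singleton_eq_bot]
    exact_mod_cast NeZero.ne n
  refine (Ideal.finite_factors hn).subset fun P hP ↦ ?_
  have h1 : ¬ (absNorm P.asIdeal).Coprime n := by rwa [← ZMod.isUnit_iff_coprime]
  obtain ⟨p, hp, hpP, hpn⟩ := Nat.Prime.not_coprime_iff_dvd.mp h1
  have hcard : absNorm P.asIdeal = Nat.card (𝓞 K ⧸ P.asIdeal) := rfl
  have := Nat.finite_of_card_ne_zero (hcard ▸ absNorm_eq_zero_iff.not.mpr P.ne_bot)
  have := Fact.mk hp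
  obtain ⟨x, hx⟩ := exists_prime_addOrderOf_dvd_card' p (hcard ▸ hpP)
  have hpx : (p : 𝓞 K ⧸ P.asIdeal) * x = 0 := by
    rw [← nsmul_eq_mul, ← hx, addOrderOf_nsmul_eq_zero]
  have hx0 : x ≠ 0 := by
    rintro rfl
    rw [addOrderOf_zero] at hx
    exact hp.one_lt.ne hx
  have hpmem : (p : 𝓞 K) ∈ P.asIdeal := by
    rw [← Ideal.Quotient.eq_zero_iff_mem, map_natCast]
    exact (mul_eq_zero.mp hpx).resolve_right hx0
  rw [Set.mem_ofPred_eq, Ideal.dvd_span_singleton]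
  exact P.asIdeal.mem_of_dvd (Nat.cast_dvd_cast hpn) hpmem

lemma exists_exp_tsum_re_rayTerm_one_le [NeZero n] (ψ : ClassGroup (𝓞 K) →* ℂ) :
    ∃ C : ℝ, 0 < C ∧ ∀ s : ℝ, 1 < s →
      Real.exp (∑' P : HeightOneSpectrum (𝓞 K),
        (rayTerm (1 : DirichletCharacter ℂ n) ψ s P.asIdeal).re) ≤
          C * ‖∑' I, classTerm ψ s I‖ := by
  classical
  set E := (finite_setOf_not_isUnit_absNorm (K := K) (n := n)).toFinset with hE
  refine ⟨Real.exp (E.card) * Real.exp (primeSqSum K), by positivity, fun s hs ↦ ?_⟩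
  let e : HeightOneSpectrum (𝓞 K) → ℝ := fun P ↦ if P ∈ E then 1 else 0
  have hes : HasSum e E.card := by
    have h : HasSum e (∑ Q ∈ E, e Q) := hasSum_sum_of_ne_finset_zero fun Q hQ ↦ if_neg hQ
    rwa [Finset.sum_congr rfl fun Q hQ ↦ if_pos hQ, Finset.sum_const, nsmul_one] at h
  have h1 : ∑' P : HeightOneSpectrum (𝓞 K),
      (rayTerm (1 : DirichletCharacter ℂ n) ψ s P.asIdeal).re ≤
      ∑' P : HeightOneSpectrum (𝓞 K), (e P + (classTerm ψ s P.asIdeal).re) := by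
    refine (summable_re_rayTerm _ ψ hs).tsum_le_tsum (fun P ↦ ?_)
      (hes.summable.add (summable_re_classTerm ψ hs))
    rw [rayTerm_apply]
    simp only [e]
    split_ifs with hP
    · rw [MulChar.map_nonunit _ ((Set.Finite.mem_toFinset _).mp hP), zero_mul, Complex.zero_re]
      have h2 := (Complex.abs_re_le_norm _).trans (norm_classTerm_le ψ s P.asIdeal)
      have h3 : (absNorm P.asIdeal : ℝ) ^ (-s) ≤ 1 := by
        refine Real.rpow_le_one_of_one_le_of_nonpos ?_ (by linarith)
        exact_mod_cast (one_le_two.trans (two_le_absNorm P))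
      linarith [(abs_le.mp h2).1]
    · rw [MulChar.one_apply (not_not.mp ((Set.Finite.mem_toFinset _).not.mp hP)), one_mul, zero_add]
  rw [hes.summable.tsum_add (summable_re_classTerm ψ hs), hes.tsum_eq] at h1
  refine (Real.exp_le_exp.mpr h1).trans ?_
  rw [Real.exp_add, mul_assoc]
  exact mul_le_mul_of_nonneg_left (norm_tsum_bounds hs (norm_classTerm_le (K := K) ψ s)).1
    (Real.exp_pos _).le

end Upper

section Main

lemma even_of_pow_odd {n k : ℕ} {χ : DirichletCharacter ℂ n} (hk : Odd k) (h : χ ^ k = 1) :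
    χ.Even := by
  refine χ.even_or_odd.resolve_right fun hodd ↦ ?_
  have h1 : (χ ^ k) (-1) = 1 := by rw [h, MulChar.one_apply isUnit_one.neg]
  rw [MulChar.pow_apply' χ hk.pos.ne', hodd, hk.neg_one_pow] at h1
  norm_num at h1

lemma exists_sq_ne_one_of_pow_odd {n k : ℕ} {χ : DirichletCharacter ℂ n} (hk : Odd k)
    (h : χ ^ k = 1) (hχ : χ ≠ 1) : ∃ u : (ZMod n)ˣ, χ u ^ 2 ≠ 1 := by
  by_contra! h2
  have h3 : χ ^ 2 = 1 := MulChar.ext fun u ↦ by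
    rw [MulChar.pow_apply_coe, h2, MulChar.one_apply_coe]
  obtain ⟨j, rfl⟩ := hk
  rw [pow_succ, pow_mul, h3, one_pow, one_mul] at h
  exact hχ h

open scoped Classical in
lemma sum_subgroup_dirichletCharacter {n : ℕ} (X : Subgroup (DirichletCharacter ℂ n)) [Fintype X]
    (a : ZMod n) : ∑ χ : X, χ.1 a = if ∀ χ ∈ X, χ a = 1 then (Nat.card X : ℂ) else 0 := by
  split_ifs with h
  · rw [Finset.sum_congr rfl fun χ _ ↦ h χ.1 χ.2]
    simp
  · push Not at h
    obtain ⟨χ₀, hχ₀, h1⟩ := h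
    have h2 : ∑ χ : X, χ.1 a = χ₀ a * ∑ χ : X, χ.1 a := by
      rw [Finset.mul_sum, ← Equiv.sum_comp (Equiv.mulLeft (⟨χ₀, hχ₀⟩ : X))]
      rfl
    have h3 : (1 - χ₀ a) * ∑ χ : X, χ.1 a = 0 := by linear_combination h2
    exact (mul_eq_zero.mp h3).resolve_left (sub_ne_zero.mpr h1.symm)

variable {K L : Type*} [Field K] [NumberField K] [Field L] [NumberField L] [Algebra K L]

/-- The primes at which all characters in `X` and the character `ψ` are trivial. -/
def trivialPrimes {n : ℕ} (X : Subgroup (DirichletCharacter ℂ n))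
    (ψ : ClassGroup (𝓞 K) →* ℂ) : Set (HeightOneSpectrum (𝓞 K)) :=
  {P | (∀ χ ∈ X, χ (absNorm P.asIdeal) = 1) ∧
    ψ (ClassGroup.mk0 ⟨P.asIdeal, mem_nonZeroDivisors_of_ne_zero P.ne_bot⟩) = 1}

lemma le_sum_tsum_re_rayTerm {n : ℕ} (X : Subgroup (DirichletCharacter ℂ n)) [Fintype X]
    (ψ : ClassGroup (𝓞 K) →* ℂ) {s : ℝ} (hs : 1 < s) :
    2 * (Nat.card X * ∑' P, (trivialPrimes X ψ).indicator
      (fun P ↦ (absNorm P.asIdeal : ℝ) ^ (-s)) P) ≤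
    ∑ χ : X, (∑' P : HeightOneSpectrum (𝓞 K), (rayTerm χ.1 1 s P.asIdeal).re +
      ∑' P : HeightOneSpectrum (𝓞 K), (rayTerm χ.1 ψ s P.asIdeal).re) := by
  classical
  have hsum : ∀ ψ : ClassGroup (𝓞 K) →* ℂ, ∀ χ : X,
      HasSum (fun P : HeightOneSpectrum (𝓞 K) ↦ (rayTerm χ.1 ψ s P.asIdeal).re)
        (∑' P : HeightOneSpectrum (𝓞 K), (rayTerm χ.1 ψ s P.asIdeal).re) :=
    fun ψ χ ↦ (summable_re_rayTerm χ.1 ψ hs).hasSum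
  have h0 := ((summable_prime_absNorm hs).indicator (trivialPrimes X ψ)).hasSum.mul_left
    (2 * (Nat.card X : ℝ))
  have h1 := hasSum_sum (s := Finset.univ) fun χ (_ : χ ∈ Finset.univ) ↦
    (hsum 1 χ).add (hsum ψ χ)
  rw [← mul_assoc]
  refine hasSum_le (fun P ↦ ?_) h0 h1
  have h2 : ∑ χ : X, ((rayTerm χ.1 1 s P.asIdeal).re + (rayTerm χ.1 ψ s P.asIdeal).re) =
      ((∑ χ : X, χ.1 (absNorm P.asIdeal)) *
        (classTerm 1 s P.asIdeal + classTerm ψ s P.asIdeal)).re := by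
    rw [Finset.sum_mul, Complex.re_sum]
    refine Finset.sum_congr rfl fun χ _ ↦ ?_
    rw [← Complex.add_re, rayTerm_apply, rayTerm_apply, ← mul_add]
  rw [h2, sum_subgroup_dirichletCharacter]
  by_cases hP : ∀ χ ∈ X, χ (absNorm P.asIdeal) = 1
  · rw [if_pos hP, ← Complex.ofReal_natCast, Complex.re_ofReal_mul, Complex.add_re,
      re_classTerm_one]
    by_cases hPψ : ψ (ClassGroup.mk0 ⟨P.asIdeal, mem_nonZeroDivisors_of_ne_zero P.ne_bot⟩) = 1
    · have h3 := classTerm_coe ψ s ⟨P.asIdeal, mem_nonZeroDivisors_of_ne_zero P.ne_bot⟩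
      rw [h3, hPψ, one_mul, Complex.ofReal_re,
        Set.indicator_of_mem (show P ∈ trivialPrimes X ψ from ⟨hP, hPψ⟩)]
      exact le_of_eq (by ring)
    · rw [Set.indicator_of_notMem (show P ∉ trivialPrimes X ψ from fun h ↦ hPψ h.2), mul_zero]
      have h4 := (Complex.abs_re_le_norm _).trans (norm_classTerm_le ψ s P.asIdeal)
      exact mul_nonneg (Nat.cast_nonneg _) (by linarith [(abs_le.mp h4).1])
  · rw [if_neg hP, Set.indicator_of_notMem (show P ∉ trivialPrimes X ψ from fun h ↦ hP h.1)]
    simp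

/-- A class group character of a real quadratic field which is trivial on the primes of relative
degree one in an extension that is contained in a ray class field of odd degree is trivial. -/
theorem RealPair.classChar_eq_one (R : RealPair K) {n : ℕ} [NeZero n]
    (X : Subgroup (DirichletCharacter ℂ n)) (hX : Odd (Nat.card X))
    (hcard : Module.finrank K L = Nat.card X) (ψ : ClassGroup (𝓞 K) →* ℂ)
    (hfin : {Q : HeightOneSpectrum (𝓞 L) | ∃ χ ∈ X, χ (absNorm Q.asIdeal) ≠ 1}.Finite)
    (hψ : ∀ Q : HeightOneSpectrum (𝓞 L),
      absNorm Q.asIdeal = absNorm (HeightOneSpectrum.under (𝓞 K) Q).asIdeal →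
      ψ (ClassGroup.mk0 ⟨(HeightOneSpectrum.under (𝓞 K) Q).asIdeal,
        mem_nonZeroDivisors_of_ne_zero (HeightOneSpectrum.under (𝓞 K) Q).ne_bot⟩) = 1) :
    ψ = 1 := by
  classical
  have := Fintype.ofFinite X
  by_contra hne
  have hXpow : ∀ χ ∈ X, χ ^ Nat.card X = 1 := fun χ hχ ↦
    congrArg Subtype.val (pow_card_eq_one' (x := (⟨χ, hχ⟩ : X)))
  let S := trivialPrimes X ψ
  have hS : {Q : HeightOneSpectrum (𝓞 L) |
      absNorm Q.asIdeal = absNorm (HeightOneSpectrum.under (𝓞 K) Q).asIdeal ∧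
        HeightOneSpectrum.under (𝓞 K) Q ∉ S}.Finite := by
    refine hfin.subset fun Q hQ ↦ ?_
    by_contra h
    simp only [Set.mem_ofPred_eq, not_exists, not_and, not_not] at h
    refine hQ.2 ⟨fun χ hχ ↦ ?_, hψ Q hQ.1⟩
    rw [← hQ.1]
    exact h χ hχ
  let F : DirichletCharacter ℂ n → (ClassGroup (𝓞 K) →* ℂ) → ℝ → ℝ := fun χ ψ s ↦
    ∑' P : HeightOneSpectrum (𝓞 K), (rayTerm χ ψ s P.asIdeal).re
  let T : ℝ → ℝ := fun s ↦
    ∑' P : HeightOneSpectrum (𝓞 K), S.indicator (fun P ↦ (absNorm P.asIdeal : ℝ) ^ (-s)) P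
  obtain ⟨C₁, hC₁⟩ := exists_tsum_absNorm_le S hS
  obtain ⟨c, hc, hlow⟩ := exists_eventually_le_exp_tsum (K := L)
  have hB : ∀ χ : X, ∃ C : ℝ, χ ≠ 1 → ∀ s : ℝ, 1 < s → s ≤ 2 → F χ 1 s + F χ ψ s ≤ C := by
    intro χ
    by_cases hχ : χ = 1
    · exact ⟨0, fun h ↦ absurd hχ h⟩
    have hχ1 : (χ : DirichletCharacter ℂ n) ≠ 1 := fun h ↦ hχ (Subtype.ext h)
    obtain ⟨u, hu⟩ := exists_sq_ne_one_of_pow_odd hX (hXpow χ χ.2) hχ1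
    have heven := even_of_pow_odd hX (hXpow χ χ.2)
    obtain ⟨A, hA⟩ := R.exists_tsum_re_rayTerm_le heven hu 1
    obtain ⟨B, hB⟩ := R.exists_tsum_re_rayTerm_le heven hu ψ
    exact ⟨A + B, fun _ s hs hs' ↦ add_le_add (hA s hs hs') (hB s hs hs')⟩
  choose B hB using hB
  obtain ⟨D, hD, hD'⟩ := exists_exp_tsum_re_rayTerm_one_le (n := n) (1 : ClassGroup (𝓞 K) →* ℂ)
  obtain ⟨D', hD0', hD''⟩ := exists_exp_tsum_re_rayTerm_one_le (n := n) ψ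
  have hsumF : ∀ s : ℝ, 1 < s → 2 * (Module.finrank K L * T s) ≤
      ∑ χ : X, (F χ 1 s + F χ ψ s) := fun s hs ↦ hcard ▸ le_sum_tsum_re_rayTerm X ψ hs
  have hupper : ∀ s : ℝ, 1 < s → s ≤ 2 →
      ∑ χ : X, (F χ 1 s + F χ ψ s) ≤ F 1 1 s + F 1 ψ s + ∑ χ ∈ Finset.univ.erase 1, B χ := by
    intro s hs hs'
    rw [← Finset.add_sum_erase _ _ (Finset.mem_univ (1 : X))]
    exact add_le_add le_rfl
      (Finset.sum_le_sum fun χ hχ ↦ hB χ (Finset.ne_of_mem_erase hχ) s hs hs')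
  set M := ∑ χ ∈ Finset.univ.erase 1, B χ with hM
  have hev : ∀ᶠ s : ℝ in 𝓝[>] 1, c ^ 2 ≤ Real.exp (2 * C₁ + M) * D * D' *
      (((s - 1) * ‖∑' I : Ideal (𝓞 K), classTerm 1 s I‖) *
        ((s - 1) * ‖∑' I, classTerm ψ s I‖)) := by
    filter_upwards [hlow, self_mem_nhdsWithin,
      nhdsWithin_le_nhds (Iic_mem_nhds (one_lt_two : (1 : ℝ) < 2))] with s h1 (hs : 1 < s) hs'
    set W := ∑' P : HeightOneSpectrum (𝓞 L), (absNorm P.asIdeal : ℝ) ^ (-s)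
    have h2 : 2 * W ≤ F 1 1 s + F 1 ψ s + (2 * C₁ + M) := by
      have h3 : W ≤ Module.finrank K L * T s + C₁ := hC₁ s hs
      linarith [hsumF s hs, hupper s hs hs']
    have h3 : Real.exp W ^ 2 ≤ (D * ‖∑' I : Ideal (𝓞 K), classTerm 1 s I‖) *
        (D' * ‖∑' I, classTerm ψ s I‖) * Real.exp (2 * C₁ + M) := by
      rw [← Real.exp_nat_mul]
      refine (Real.exp_le_exp.mpr h2).trans ?_
      rw [Real.exp_add, Real.exp_add]
      refine mul_le_mul_of_nonneg_right ?_ (Real.exp_pos _).le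
      exact mul_le_mul (hD' s hs) (hD'' s hs) (Real.exp_pos _).le (by positivity)
    calc c ^ 2 ≤ ((s - 1) * Real.exp W) ^ 2 := by gcongr
      _ = (s - 1) ^ 2 * Real.exp W ^ 2 := by ring
      _ ≤ (s - 1) ^ 2 * ((D * ‖∑' I : Ideal (𝓞 K), classTerm 1 s I‖) *
        (D' * ‖∑' I, classTerm ψ s I‖) * Real.exp (2 * C₁ + M)) := by gcongr
      _ = _ := by ring
  have hlim := ((tendsto_sub_one_mul_tsum_classTerm_one (K := K)).mul
    (tendsto_sub_one_mul_tsum_classTerm hne)).const_mul (Real.exp (2 * C₁ + M) * D * D')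
  rw [mul_zero, mul_zero] at hlim
  exact absurd (ge_of_tendsto hlim hev) (not_le.mpr (by positivity))

end Main
end NormSurjective

section ClassNorm

open Filter Topology NumberField Ideal IsDedekindDomain
open scoped nonZeroDivisors

variable (K L : Type*) [Field K] [NumberField K] [Field L] [NumberField L] [Algebra K L]

/-- The relative norm of a nonzero ideal. -/
noncomputable def idealNorm : (Ideal (𝓞 L))⁰ →* (Ideal (𝓞 K))⁰ where
  toFun I := ⟨relNorm (𝓞 K) I.1, mem_nonZeroDivisors_of_ne_zero
    (relNorm_eq_bot_iff.not.mpr (nonZeroDivisors.coe_ne_zero I))⟩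
  map_one' := Subtype.ext (map_one (relNorm (𝓞 K)))
  map_mul' I J := Subtype.ext (map_mul (relNorm (𝓞 K)) I.1 J.1)

lemma mk0_idealNorm_eq {I J : (Ideal (𝓞 L))⁰} (h : ClassGroup.mk0 I = ClassGroup.mk0 J) :
    ClassGroup.mk0 (idealNorm K L I) = ClassGroup.mk0 (idealNorm K L J) := by
  rw [ClassGroup.mk0_eq_mk0_iff] at h ⊢
  obtain ⟨x, y, hx, hy, h⟩ := h
  refine ⟨Algebra.intNorm (𝓞 K) (𝓞 L) x, Algebra.intNorm (𝓞 K) (𝓞 L) y, ?_, ?_, ?_⟩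
  · rwa [Algebra.intNorm_ne_zero]
  · rwa [Algebra.intNorm_ne_zero]
  · have := congrArg (relNorm (𝓞 K)) h
    rwa [map_mul, map_mul, relNorm_singleton, relNorm_singleton] at this

/-- The norm map of class groups. -/
noncomputable def classNorm : ClassGroup (𝓞 L) →* ClassGroup (𝓞 K) where
  toFun C := ClassGroup.mk0 (idealNorm K L (ClassGroup.mk0_surjective C).choose)
  map_one' := by
    rw [mk0_idealNorm_eq K L (J := 1), map_one, map_one]
    rw [(ClassGroup.mk0_surjective (1 : ClassGroup (𝓞 L))).choose_spec, map_one]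
  map_mul' C C' := by
    rw [← map_mul, ← map_mul]
    refine mk0_idealNorm_eq K L ?_
    rw [map_mul, (ClassGroup.mk0_surjective _).choose_spec, (ClassGroup.mk0_surjective _).choose_spec,
      (ClassGroup.mk0_surjective _).choose_spec]

lemma classNorm_mk0 (I : (Ideal (𝓞 L))⁰) :
    classNorm K L (ClassGroup.mk0 I) = ClassGroup.mk0 (idealNorm K L I) :=
  mk0_idealNorm_eq K L (ClassGroup.mk0_surjective _).choose_spec

lemma classNorm_extendedHom (C : ClassGroup (𝓞 K)) :
    classNorm K L (ClassGroup.extendedHom (𝓞 K) (𝓞 L) C) = C ^ Module.finrank K L := by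
  obtain ⟨I, rfl⟩ := ClassGroup.mk0_surjective C
  rw [ClassGroup.extendedHom_mk0, classNorm_mk0, ← map_pow]
  congr 1
  refine Subtype.ext ?_
  rw [IsFractionRing.finrank_eq (𝓞 K) K (𝓞 L) L]
  exact relNorm_algebraMap _ _

/-- For an extension `L` of odd degree of a real quadratic field `K`, the norm map of class groups is
surjective if all but finitely many primes of `L` have norm in the kernel of `[L : K]` Dirichlet
characters. -/
theorem classNorm_surjective (h2 : Module.finrank ℚ K = 2) [IsTotallyReal K] {n : ℕ} [NeZero n]
    (X : Subgroup (DirichletCharacter ℂ n)) (hX : Odd (Nat.card X))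
    (hcard : Module.finrank K L = Nat.card X)
    (hfin : {Q : HeightOneSpectrum (𝓞 L) | ∃ χ ∈ X, χ (absNorm Q.asIdeal) ≠ 1}.Finite) :
    Function.Surjective (classNorm K L) := by
  obtain ⟨R⟩ := nonempty_realPair h2
  rw [← MonoidHom.range_eq_top]
  by_contra hne
  obtain ⟨C, hC⟩ : ∃ C, C ∉ (classNorm K L).range := by
    by_contra! h
    exact hne ((Subgroup.eq_top_iff' _).mpr h)
  obtain ⟨φ, hφ⟩ := CommGroup.exists_apply_ne_one_of_hasEnoughRootsOfUnity
    (ClassGroup (𝓞 K) ⧸ (classNorm K L).range) ℂ (a := (C : ClassGroup (𝓞 K) ⧸ _))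
    (by rwa [Ne, QuotientGroup.eq_one_iff])
  let ψ : ClassGroup (𝓞 K) →* ℂ :=
    (Units.coeHom ℂ).comp (φ.comp (QuotientGroup.mk' (classNorm K L).range))
  have hψ : ψ = 1 := by
    refine R.classChar_eq_one X hX hcard ψ hfin fun Q hQ ↦ ?_
    obtain ⟨f, hf0, hf1, hf2⟩ := exists_absNorm_eq_pow (K := K) Q
    set P := HeightOneSpectrum.under (𝓞 K) Q
    have hf : f = 1 := by
      rw [hQ] at hf2
      exact (Nat.pow_right_injective (two_le_absNorm P) ((pow_one _).trans hf2)).symm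
    have h1 : ClassGroup.mk0 ⟨P.asIdeal, mem_nonZeroDivisors_of_ne_zero P.ne_bot⟩ =
        classNorm K L (ClassGroup.mk0 ⟨Q.asIdeal, mem_nonZeroDivisors_of_ne_zero Q.ne_bot⟩) := by
      rw [classNorm_mk0]
      congr 1
      refine Subtype.ext ?_
      rw [hf, pow_one] at hf1
      exact hf1.symm
    have h3 : ((classNorm K L (ClassGroup.mk0 ⟨Q.asIdeal, mem_nonZeroDivisors_of_ne_zero Q.ne_bot⟩) :
        ClassGroup (𝓞 K)) : ClassGroup (𝓞 K) ⧸ (classNorm K L).range) = 1 :=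
      (QuotientGroup.eq_one_iff _).mpr ⟨_, rfl⟩
    change ((φ _ : ℂˣ) : ℂ) = 1
    rw [h1, QuotientGroup.mk'_apply, h3, map_one, Units.val_one]
  have h4 : ψ C = 1 := by rw [hψ, MonoidHom.one_apply]
  exact hφ (Units.ext h4)

end ClassNorm

section CyclotomicCharacters

open NumberField Ideal IsDedekindDomain

variable {L C : Type*} [Field L] [NumberField L] [Field C] [NumberField C] [Algebra L C]
  {n : ℕ} [NeZero n] [IsCyclotomicExtension {n} ℚ C]

attribute [local instance] Ideal.Quotient.field in
lemma mapRingHom_sub_pow_mem (Q : Ideal (𝓞 L)) [Q.IsMaximal] (hQ : Q ≠ ⊥)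
    (P : Ideal (𝓞 C)) [P.LiesOver Q] {σ : Gal(C/ℚ)}
    (hσ : ((IsCyclotomicExtension.Rat.galEquivZMod n C σ : (ZMod n)ˣ) : ZMod n) = absNorm Q)
    (x : 𝓞 C) : RingOfIntegers.mapRingHom (σ : C →+* C) x - x ^ absNorm Q ∈ P := by
  have : Finite (𝓞 L ⧸ Q) := finiteQuotientOfFreeOfNeBot Q hQ
  have := Fintype.ofFinite (𝓞 L ⧸ Q)
  have hcard : Fintype.card (𝓞 L ⧸ Q) = absNorm Q := by
    rw [absNorm_apply, Submodule.cardQuot_apply, Nat.card_eq_fintype_card]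
  have hζ := IsCyclotomicExtension.zeta_spec n ℚ C
  let f : 𝓞 C →ₐ[ℤ] 𝓞 C ⧸ P :=
    ((Ideal.Quotient.mk P).comp (RingOfIntegers.mapRingHom (σ : C →+* C))).toIntAlgHom
  let g : 𝓞 C →ₐ[ℤ] 𝓞 C ⧸ P :=
    ((FiniteField.frobeniusAlgHom (𝓞 L ⧸ Q) (𝓞 C ⧸ P)).toRingHom.comp
      (Ideal.Quotient.mk P)).toIntAlgHom
  have hg (y) : g y = Ideal.Quotient.mk P (y ^ absNorm Q) := by
    rw [map_pow, ← hcard]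
    rfl
  have hfg : f = g := by
    refine AlgHom.ext_of_adjoin_eq_top
      (IsCyclotomicExtension.Rat.adjoin_singleton_eq_top (K := C) hζ) ?_
    rintro _ rfl
    rw [hg]
    change Ideal.Quotient.mk P _ = _
    congr 1
    refine RingOfIntegers.ext ?_
    change σ (IsCyclotomicExtension.zeta n ℚ C) = IsCyclotomicExtension.zeta n ℚ C ^ absNorm Q
    rw [IsCyclotomicExtension.Rat.galEquivZMod_apply_of_pow_eq n C σ hζ.pow_eq_one, hσ,
      ZMod.val_natCast, ← pow_eq_pow_mod _ hζ.pow_eq_one]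
  rw [← Ideal.Quotient.eq, ← hg, ← hfg]
  rfl

attribute [local instance] Ideal.Quotient.field in
lemma finite_setOf_frobenius_ne {σ : Gal(C/ℚ)}
    (hσ : ∃ x : L, σ (algebraMap L C x) ≠ algebraMap L C x) :
    {Q : HeightOneSpectrum (𝓞 L) |
      ((IsCyclotomicExtension.Rat.galEquivZMod n C σ : (ZMod n)ˣ) : ZMod n) =
        absNorm Q.asIdeal}.Finite := by
  obtain ⟨y, hy⟩ : ∃ y : 𝓞 L, σ (algebraMap L C y) ≠ algebraMap L C y := by
    by_contra! h
    obtain ⟨x, hx⟩ := hσ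
    obtain ⟨a, b, hb, rfl⟩ := IsFractionRing.div_surjective (A := 𝓞 L) x
    exact hx (by simp only [map_div₀, h])
  let z : 𝓞 C := algebraMap (𝓞 L) (𝓞 C) y
  let w : 𝓞 C := RingOfIntegers.mapRingHom (σ : C →+* C) z - z
  have hw : Ideal.span {w} ≠ 0 := by
    rw [Ne, Ideal.zero_eq_bot, Ideal.span_singleton_eq_bot, sub_eq_zero]
    exact fun h ↦ hy (congrArg (algebraMap (𝓞 C) C) h)
  refine ((Ideal.finite_factors hw).image (HeightOneSpectrum.under (𝓞 L))).subset fun Q hQ ↦ ?_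
  obtain ⟨P, hP, hPQ⟩ := exists_maximal_ideal_liesOver_of_isIntegral (S := 𝓞 C) Q.asIdeal
  have hP0 : P ≠ ⊥ := Ideal.ne_bot_of_liesOver_of_ne_bot Q.ne_bot P
  refine ⟨⟨P, hP.isPrime, hP0⟩, ?_, HeightOneSpectrum.ext (over_def P Q.asIdeal).symm⟩
  have h1 := mapRingHom_sub_pow_mem Q.asIdeal Q.ne_bot P hQ z
  have h2 : z ^ absNorm Q.asIdeal - z ∈ P := by
    have h : y ^ absNorm Q.asIdeal - y ∈ Q.asIdeal := by
      have : Finite (𝓞 L ⧸ Q.asIdeal) := finiteQuotientOfFreeOfNeBot _ Q.ne_bot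
      have := Fintype.ofFinite (𝓞 L ⧸ Q.asIdeal)
      rw [← Ideal.Quotient.eq, map_pow, absNorm_apply, Submodule.cardQuot_apply,
        Nat.card_eq_fintype_card]
      exact FiniteField.pow_card _
    have h3 := (mem_of_liesOver P Q.asIdeal _).mp h
    rwa [map_sub, map_pow] at h3
  change P ∣ _
  rw [Ideal.dvd_span_singleton]
  simpa [w] using P.add_mem h1 h2

lemma card_range_sq {Y : Type*} [CommGroup Y] {k : ℕ} (hk : Odd k) (hY : Nat.card Y = 2 * k) :
    Nat.card (powMonoidHom 2 : Y →* Y).range = k := by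
  have : Finite Y := Nat.finite_of_card_ne_zero (by have := hk.pos; omega)
  set s : Y →* Y := powMonoidHom 2
  have hpow (x : s.ker) : x ^ 2 = 1 := Subtype.ext x.2
  have : Fact (Nat.Prime 2) := ⟨Nat.prime_two⟩
  obtain ⟨x, hx⟩ := exists_prime_orderOf_dvd_card' 2 (hY ▸ dvd_mul_right 2 k)
  obtain ⟨a, ha⟩ := IsPGroup.iff_card.mp
    (fun x ↦ ⟨1, by rw [pow_one, hpow x]⟩ : IsPGroup 2 s.ker)
  have h1 : s.ker ≠ ⊥ := fun h ↦ by
    have hxs : x ∈ s.ker := by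
      change x ^ 2 = 1
      rw [← hx, pow_orderOf_eq_one]
    rw [h, Subgroup.mem_bot] at hxs
    simp [hxs] at hx
  have h := s.ker.card_eq_card_quotient_mul_card_subgroup
  rw [Nat.card_congr (QuotientGroup.quotientKerEquivRange s).toEquiv, hY, ha] at h
  have ha0 : a ≠ 0 := by
    rintro rfl
    exact h1 (Subgroup.eq_bot_of_card_eq _ (by rw [ha, pow_zero]))
  obtain ⟨b, rfl⟩ := Nat.exists_eq_succ_of_ne_zero ha0
  have h2 : k = Nat.card s.range * 2 ^ b := by
    rw [Nat.pow_succ] at h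
    linarith
  obtain rfl | hb := eq_or_ne b 0
  · rw [h2, pow_zero, mul_one]
  · rw [h2, Nat.odd_mul] at hk
    exact absurd hk.2 (Nat.not_odd_iff_even.mpr ((Nat.even_pow.mpr ⟨even_two, hb⟩)))

lemma exists_subgroup_dirichletCharacter_odd (L C : Type*) [Field L] [NumberField L] [Field C]
    [NumberField C] [Algebra L C] (n : ℕ) [NeZero n] [IsCyclotomicExtension {n} ℚ C]
    (h : ∃ k, Odd k ∧ Module.finrank ℚ L = 2 * k) :
    ∃ X : Subgroup (DirichletCharacter ℂ n), Odd (Nat.card X) ∧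
      Module.finrank ℚ L = 2 * Nat.card X ∧
      {Q : HeightOneSpectrum (𝓞 L) | ∃ χ ∈ X, χ (absNorm Q.asIdeal) ≠ 1}.Finite := by
  have := IsCyclotomicExtension.isAbelianGalois {n} ℚ C
  let F : IntermediateField ℚ C := (IsScalarTower.toAlgHom ℚ L C).fieldRange
  have hF : Module.finrank ℚ F = Module.finrank ℚ L :=
    (AlgEquiv.ofInjectiveField (IsScalarTower.toAlgHom ℚ L C)).toLinearEquiv.finrank_eq.symm
  let Y := IsCyclotomicExtension.Rat.intermediateFieldEquivSubgroupChar n C ℂ F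
  have hY : Nat.card Y = Module.finrank ℚ L := by
    rw [← hF]
    exact IsCyclotomicExtension.Rat.card_intermediateFieldEquivSubgroupChar n C ℂ F
  obtain ⟨k, hk, hkL⟩ := h
  let s : Y →* Y := powMonoidHom 2
  have hs : Nat.card s.range = k := card_range_sq hk (hY.trans hkL)
  let X : Subgroup (DirichletCharacter ℂ n) := s.range.map Y.subtype
  have hX : Nat.card X = k := by
    rw [← hs]
    exact (Nat.card_congr (s.range.equivMapOfInjective _ Y.subtype_injective).toEquiv).symm
  refine ⟨X, hX ▸ hk, by rw [hX, hkL], ?_⟩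
  have hfin : (⋃ σ ∈ {σ : Gal(C/ℚ) | ∃ x : L, σ (algebraMap L C x) ≠ algebraMap L C x},
      {Q : HeightOneSpectrum (𝓞 L) |
      ((IsCyclotomicExtension.Rat.galEquivZMod n C σ : (ZMod n)ˣ) : ZMod n) =
        absNorm Q.asIdeal}).Finite :=
    Set.Finite.biUnion (Set.toFinite _) fun σ hσ ↦ finite_setOf_frobenius_ne hσ
  refine ((finite_setOf_not_isUnit_absNorm (K := L) (n := n)).union hfin).subset fun Q hQ ↦ ?_
  obtain ⟨_, ⟨_, ⟨χ, rfl⟩, rfl⟩, hχ⟩ := hQ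
  by_contra hcon
  simp only [Set.mem_union, not_or, Set.mem_ofPred_eq, not_not, Set.mem_iUnion, not_exists] at hcon
  obtain ⟨⟨u, hu⟩, hcon⟩ := hcon
  let σ := (IsCyclotomicExtension.Rat.galEquivZMod n C).symm u
  have hσu : ((IsCyclotomicExtension.Rat.galEquivZMod n C σ : (ZMod n)ˣ) : ZMod n) =
      absNorm Q.asIdeal := by rw [← hu, MulEquiv.apply_symm_apply]
  have hσ : σ ∈ F.fixingSubgroup := by
    rw [IntermediateField.mem_fixingSubgroup_iff]
    rintro _ ⟨x, rfl⟩
    by_contra hx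
    exact hcon σ ⟨x, hx⟩ hσu
  have h1 := (IsCyclotomicExtension.Rat.mem_intermediateFieldEquivSubgroupChar_iff n C ℂ F
    χ.1).mp χ.2 σ hσ
  rw [hσu] at h1
  refine hχ ?_
  change (χ.1 ^ 2) _ = 1
  rw [← hu] at h1 ⊢
  rw [MulChar.pow_apply_coe, h1, one_pow]

end CyclotomicCharacters

section PRank

open Module

lemma mem_pPart {G : Type*} [CommGroup G] {p : ℕ} (hp : p.Prime) {x : G} :
    x ∈ pPart G p hp ↔ ∃ k, x ^ p ^ k = 1 := by
  have : Fact p.Prime := ⟨hp⟩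
  exact CommGroup.mem_primaryComponent

/-- The restriction of a homomorphism to the `p`-parts. -/
def pPartMap {G G' : Type*} [CommGroup G] [CommGroup G'] {p : ℕ} (hp : p.Prime) (f : G →* G') :
    pPart G p hp →* pPart G' p hp :=
  (f.comp (pPart G p hp).subtype).codRestrict _ fun x ↦ by
    obtain ⟨k, hk⟩ := (mem_pPart hp).mp x.2
    exact (mem_pPart hp).mpr ⟨k, by simp [← map_pow, hk]⟩

lemma pRank_eq_factorization_card_ker {G : Type*} [CommGroup G] [Finite G] {p : ℕ}
    (hp : p.Prime) : pRank G p hp =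
      (Nat.card (powMonoidHom p : pPart G p hp →* pPart G p hp).ker).factorization p := by
  rw [pRank]
  congr 2
  set f : pPart G p hp →* pPart G p hp := powMonoidHom p
  have h1 := f.range.card_eq_card_quotient_mul_card_subgroup
  have h2 := f.ker.card_eq_card_quotient_mul_card_subgroup
  rw [Nat.card_congr (QuotientGroup.quotientKerEquivRange f).toEquiv, h1, mul_comm] at h2
  exact Nat.eq_of_mul_eq_mul_left Nat.card_pos h2

lemma pPartMap_surjective {G G' : Type*} [CommGroup G] [CommGroup G'] [Finite G] {p : ℕ}
    (hp : p.Prime) (f : G →* G') (hf : Function.Surjective f) :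
    Function.Surjective (pPartMap hp f) := by
  rintro ⟨y, hy⟩
  obtain ⟨k, hk⟩ := (mem_pPart hp).mp hy
  obtain ⟨x, rfl⟩ := hf y
  obtain ⟨a, m, hm, hxm⟩ := Nat.exists_eq_pow_mul_and_not_dvd (orderOf_pos x).ne' p hp.ne_one
  obtain ⟨u, hu1, hu2⟩ := Nat.chineseRemainder
    (((Nat.Prime.coprime_iff_not_dvd hp).mpr hm).pow_left k) 1 0
  refine ⟨⟨x ^ u, (mem_pPart hp).mpr ⟨a, ?_⟩⟩, Subtype.ext ?_⟩
  · rw [← pow_mul, ← orderOf_dvd_iff_pow_eq_one, hxm, mul_comm]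
    exact mul_dvd_mul_right (Nat.modEq_zero_iff_dvd.mp hu2) _
  · change f (x ^ u) = f x
    rw [map_pow]
    conv_rhs => rw [← pow_one (f x)]
    exact pow_eq_pow_iff_modEq.mpr (hu1.of_dvd (orderOf_dvd_of_pow_eq_one hk))

lemma pRank_eq_of_surjective {G G' : Type*} [CommGroup G] [CommGroup G'] [Finite G] {p : ℕ}
    (hp : p.Prime) (f : G →* G') (hf : Function.Surjective f)
    (hcard : pCard G p hp = pCard G' p hp) : pRank G p hp = pRank G' p hp := by
  have : Finite G' := Finite.of_surjective f hf
  have hb : Function.Bijective (pPartMap hp f) :=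
    (Nat.bijective_iff_surjective_and_card _).mpr ⟨pPartMap_surjective hp f hf, hcard⟩
  let e := MulEquiv.ofBijective _ hb
  rw [pRank_eq_factorization_card_ker, pRank_eq_factorization_card_ker]
  congr 2
  refine Nat.card_congr (e.toEquiv.subtypeEquiv fun x ↦ ?_)
  change x ^ p = 1 ↔ e x ^ p = 1
  rw [← map_pow, EmbeddingLike.map_eq_one_iff]

lemma pRank_eq_one_add {G G' : Type*} [CommGroup G] [CommGroup G'] [Finite G] [Finite G'] {p : ℕ}
    (hp : p.Prime) (N : G →* G') (j : G' →* G) {k : ℕ} (hNj : ∀ x, N (j x) = x ^ k)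
    (hk : k.Coprime p) (hcard : pCard G p hp = p * pCard G' p hp) :
    pRank G p hp = 1 + pRank G' p hp := by
  have : Fact p.Prime := ⟨hp⟩
  set N' := pPartMap hp N
  set j' := pPartMap hp j
  have hcomp (x) : N' (j' x) = x ^ k := Subtype.ext (hNj x)
  have hroot (y : pPart G' p hp) : ∃ u : ℕ, (y ^ u) ^ k = y := by
    obtain ⟨a, ha⟩ := (mem_pPart hp).mp y.2
    have ha' : y ^ p ^ a = 1 := Subtype.ext ha
    obtain ⟨u, -, hu⟩ := Nat.exists_mul_mod_eq_one_of_coprime (hk.pow_right (a + 1))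
      (Nat.one_lt_pow a.succ_ne_zero hp.one_lt)
    refine ⟨u, ?_⟩
    rw [← pow_mul, mul_comm u k]
    conv_rhs => rw [← pow_one y]
    refine pow_eq_pow_iff_modEq.mpr (Nat.ModEq.of_dvd ?_ (?_ : k * u ≡ 1 [MOD p ^ (a + 1)]))
    · exact (orderOf_dvd_of_pow_eq_one ha').trans (pow_dvd_pow p a.le_succ)
    · rw [Nat.ModEq, hu, Nat.mod_eq_of_lt (Nat.one_lt_pow a.succ_ne_zero hp.one_lt)]
  have hN's : Function.Surjective N' := fun y ↦ by
    obtain ⟨u, hu⟩ := hroot y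
    exact ⟨j' (y ^ u), by rw [hcomp, hu]⟩
  have hkerN : Nat.card N'.ker = p := by
    have h := N'.ker.card_eq_card_quotient_mul_card_subgroup
    rw [Nat.card_congr (QuotientGroup.quotientKerEquivOfSurjective N' hN's).toEquiv] at h
    change pCard G p hp = pCard G' p hp * _ at h
    rw [hcard, mul_comm] at h
    exact (Nat.eq_of_mul_eq_mul_left Nat.card_pos h).symm
  let T := (powMonoidHom p : pPart G p hp →* pPart G p hp).ker
  let T' := (powMonoidHom p : pPart G' p hp →* pPart G' p hp).ker
  let M : T →* T' := (N'.comp T.subtype).codRestrict T' fun x ↦ by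
    have hx : (x : pPart G p hp) ^ p = 1 := x.2
    change N' x ^ p = 1
    rw [← map_pow, hx, map_one]
  have hM : Function.Surjective M := fun y ↦ by
    obtain ⟨u, hu⟩ := hroot y.1
    have hy : (y : pPart G' p hp) ^ p = 1 := y.2
    refine ⟨⟨j' (y.1 ^ u), ?_⟩, Subtype.ext ?_⟩
    · change j' (y.1 ^ u) ^ p = 1
      rw [← map_pow, ← pow_mul, mul_comm, pow_mul, hy, one_pow, map_one]
    · change N' (j' (y.1 ^ u)) = y.1
      rw [hcomp, hu]
  have hkerM : Nat.card M.ker = p := by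
    have hpow (x : N'.ker) : x.1 ^ p = 1 := by
      have h : x ^ Nat.card N'.ker = 1 := pow_card_eq_one'
      rw [hkerN] at h
      exact congrArg Subtype.val h
    exact (Nat.card_congr ⟨fun x ↦ ⟨x.1.1, congrArg Subtype.val (x.2 : M x.1 = 1)⟩,
      fun x ↦ ⟨⟨x.1, hpow x⟩, Subtype.ext x.2⟩, fun _ ↦ rfl, fun _ ↦ rfl⟩).trans hkerN
  have hT : Nat.card T = Nat.card T' * p := by
    have h := M.ker.card_eq_card_quotient_mul_card_subgroup
    rwa [Nat.card_congr (QuotientGroup.quotientKerEquivOfSurjective M hM).toEquiv, hkerM] at h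
  rw [pRank_eq_factorization_card_ker, pRank_eq_factorization_card_ker]
  change (Nat.card T).factorization p = 1 + (Nat.card T').factorization p
  rw [hT, Nat.factorization_mul Nat.card_pos.ne' hp.ne_zero, Finsupp.add_apply,
    hp.factorization_self, add_comm]

end PRank

section Field

lemma zetaC_inv_eq_conj {n : ℕ} (hn : n ≠ 0) : (zetaC n)⁻¹ = starRingEnd ℂ (zetaC n) :=
  Complex.inv_eq_conj (Complex.norm_eq_one_of_pow_eq_one (zetaC_pow n hn) hn)

lemma conj_eq_of_mem_realCyclo {n : ℕ} (hn : n ≠ 0) {x : ℂ} (hx : x ∈ realCyclo n) :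
    starRingEnd ℂ x = x := by
  have h : realCyclo n ≤ (Complex.ofRealAm.restrictScalars ℚ).fieldRange := by
    rw [realCyclo, adjoin_simple_le_iff, zetaC_inv_eq_conj hn, Complex.add_conj]
    exact ⟨_, rfl⟩
  obtain ⟨r, rfl⟩ := h hx
  exact Complex.conj_ofReal r

lemma isTotallyReal_of_le_realCyclo {n : ℕ} (hn : n ≠ 0) (K : IntermediateField ℚ ℂ)
    [FiniteDimensional ℚ K] (hK : K ≤ realCyclo n) (h2 : finrank ℚ K = 2) : IsTotallyReal K := by
  have h0 : ComplexEmbedding.IsReal (algebraMap K ℂ) :=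
    RingHom.ext fun x ↦ conj_eq_of_mem_realCyclo hn (hK x.2)
  have h1 : 0 < InfinitePlace.nrRealPlaces K := by
    classical exact Fintype.card_pos_iff.mpr ⟨⟨_, InfinitePlace.isReal_mk_iff.mpr h0⟩⟩
  have h3 := InfinitePlace.card_add_two_mul_card_eq_rank K
  rw [← nrComplexPlaces_eq_zero_iff]
  omega

lemma realCyclo_le_adjoin_zetaC (n : ℕ) : realCyclo n ≤ ℚ⟮zetaC n⟯ := by
  rw [realCyclo, adjoin_simple_le_iff]
  have h := mem_adjoin_simple_self ℚ (zetaC n)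
  exact add_mem h (inv_mem h)

lemma isCyclotomicExtension_adjoin_zetaC (n : ℕ) [NeZero n] :
    IsCyclotomicExtension {n} ℚ ℚ⟮zetaC n⟯ := by
  have h : IsPrimitiveRoot (zetaC n) n := Complex.isPrimitiveRoot_exp n (NeZero.ne n)
  change IsCyclotomicExtension {n} ℚ ℚ⟮zetaC n⟯.toSubalgebra
  rw [adjoin_simple_toSubalgebra_of_isAlgebraic
    (isIntegral_of_pow_eq_one (NeZero.ne n) (zetaC_pow n (NeZero.ne n))).isAlgebraic]
  exact h.adjoin_isCyclotomicExtension ℚ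

end Field

/-- subcase II.2 of the proof of Theorem 1.2, stable case. -/
theorem statement_15
    (n ℓ q m : ℕ) (hn : 0 < n) (hℓ : ℓ.Prime) (hℓodd : Odd ℓ)
    (hq : q.Prime) (hqn : q ∣ n) (hqℓ : q ≡ 1 [MOD ℓ]) (hm : 1 ≤ m)
    (K₂ Kl : IntermediateField ℚ ℂ) [FiniteDimensional ℚ K₂] [FiniteDimensional ℚ Kl]
    (hK₂H : K₂ ≤ realCyclo n) (hK₂deg : Module.finrank ℚ K₂ = 2)
    (hKl : Kl ≤ realCyclo q) (hKldeg : Module.finrank ℚ Kl = ℓ)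
    (i : ℕ) (hi : ℓ ^ i ∣ Module.finrank ℚ (realCyclo n))
    (hi' : ¬ ℓ ^ (i + 1) ∣ Module.finrank ℚ (realCyclo n))
    (K₂li : IntermediateField ℚ ℂ) [FiniteDimensional ℚ K₂li]
    (hsubi : K₂ ⊔ Kl ≤ K₂li) (hK₂liH : K₂li ≤ realCyclo n)
    (hdegi : Module.finrank ℚ K₂li = ℓ ^ (i - 1) * Module.finrank ℚ ↥(K₂ ⊔ Kl))
    (hH : pCard (ClassGroup (𝓞 (realCyclo n))) ℓ hℓ = ℓ ^ m)
    (hK₂cl : pCard (ClassGroup (𝓞 K₂)) ℓ hℓ = ℓ ^ (m - 1))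
    (hK₂lcl : pCard (ClassGroup (𝓞 ↥(K₂ ⊔ Kl))) ℓ hℓ = ℓ ^ (m - 1))
    (hsub : K₂ ⊔ Kl ≤ realCyclo n)
    (d : ℕ) (hd : Module.finrank ℚ (realCyclo n) = d * Module.finrank ℚ ↥(K₂ ⊔ Kl))
    (hdvd : ℓ ∣ d)
    (hK₂licl : pCard (ClassGroup (𝓞 K₂li)) ℓ hℓ = ℓ ^ (m - 1)) :
    pRank (ClassGroup (𝓞 (realCyclo n))) ℓ hℓ = 1 + pRank (ClassGroup (𝓞 K₂)) ℓ hℓ := by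
  have : NeZero n := ⟨hn.ne'⟩
  have hsup : finrank ℚ ↥(K₂ ⊔ Kl) = 2 * ℓ := by
    have h : K₂.LinearDisjoint Kl := LinearDisjoint.of_finrank_coprime (by
      rw [hK₂deg, hKldeg]
      exact Nat.coprime_two_left.mpr hℓodd)
    rw [h.finrank_sup, hK₂deg, hKldeg]
  have hi1 : 1 ≤ i := by
    by_contra! h
    obtain rfl : i = 0 := by omega
    exact hi' (by rw [hd, zero_add, pow_one]; exact hdvd.mul_right _)
  have hLdeg : finrank ℚ K₂li = 2 * ℓ ^ i := by
    rw [hdegi, hsup, ← Nat.sub_add_cancel hi1, pow_succ, Nat.add_sub_cancel]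
    ring
  let algKL : Algebra K₂ K₂li := (inclusion (le_sup_left.trans hsubi)).toRingHom.toAlgebra
  let algLH : Algebra K₂li (realCyclo n) := (inclusion hK₂liH).toRingHom.toAlgebra
  have hKL : finrank K₂ K₂li = ℓ ^ i := by
    have h := finrank_mul_finrank ℚ K₂ K₂li
    rw [hK₂deg, hLdeg] at h
    omega
  have hLH : (finrank K₂li (realCyclo n)).Coprime ℓ := by
    have h := finrank_mul_finrank ℚ K₂li (realCyclo n)
    rw [Nat.coprime_comm, hℓ.coprime_iff_not_dvd]
    rintro ⟨c, hc⟩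
    exact hi' ⟨2 * c, by rw [← h, hLdeg, hc]; ring⟩
  have hN : Function.Surjective (classNorm K₂ K₂li) := by
    have := isCyclotomicExtension_adjoin_zetaC n
    have : FiniteDimensional ℚ ℚ⟮zetaC n⟯ :=
      IsCyclotomicExtension.finiteDimensional {n} ℚ _
    let algLC : Algebra K₂li ℚ⟮zetaC n⟯ :=
      (inclusion (hK₂liH.trans (realCyclo_le_adjoin_zetaC n))).toRingHom.toAlgebra
    obtain ⟨X, hX, hcard, hfin⟩ := exists_subgroup_dirichletCharacter_odd K₂li ℚ⟮zetaC n⟯ n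
      ⟨ℓ ^ i, hℓodd.pow, hLdeg⟩
    have := isTotallyReal_of_le_realCyclo hn.ne' K₂ hK₂H hK₂deg
    exact classNorm_surjective K₂ K₂li hK₂deg X hX (by omega) hfin
  rw [pRank_eq_one_add hℓ (classNorm K₂li (realCyclo n))
    (ClassGroup.extendedHom (𝓞 K₂li) (𝓞 (realCyclo n))) (classNorm_extendedHom K₂li _) hLH
    (by rw [hH, hK₂licl, ← pow_succ', Nat.sub_add_cancel hm]),
    pRank_eq_of_surjective hℓ _ hN (hK₂licl.trans hK₂cl.symm)]

end PaperStmt
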